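/- arXiv:1903.02936 — 5 statements merged into one kernel-verified Lean document; each statement's English description precedes it below -/
import Mathlib

section
/- (Wiener–Itô chaos expansion theorem.) Let P be a white noise probability measure on 𝒮'(ℝ). Then the family {(α!)^{−1/2} H_α}_{α ∈ 𝒥} is an orthonormal Hilbert basis of the real Hilbert space L²(𝒮'(ℝ), P): it is orthonormal and its closed linear span is all of L²(P). Consequently, every X ∈ L²(P) admits a unique expansion X = Σ_{α ∈ 𝒥} c_α H_α (convergent in L²(P)) with real coefficients c_α, and ‖X‖²_{L²(P)} = Σ_{α ∈ 𝒥} α!·c_α². -/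
open MeasureTheory

noncomputable section

/-- The Schwartz space `𝒮(ℝ)` of rapidly decreasing smooth real functions. -/
abbrev SchwartzR := SchwartzMap ℝ ℝ

/-- The space of tempered distributions `𝒮'(ℝ)` with the weak-* topology. -/
abbrev TemperedDistR := WeakDual ℝ SchwartzR

/-- The Borel σ-algebra of the weak-* topology on `𝒮'(ℝ)`. -/
instance : MeasurableSpace TemperedDistR := borel TemperedDistR

/-- The `n`-th probabilists' Hermite polynomial
`hₙ(x) = (−1)ⁿ e^{x²/2} (dⁿ/dxⁿ) e^{−x²/2}`. -/
def hermiteP (n : ℕ) (x : ℝ) : ℝ :=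
  (-1 : ℝ)^n * Real.exp (x^2 / 2) * iteratedDeriv n (fun y => Real.exp (-(y^2) / 2)) x

/-- The `k`-th Hermite function (`k ≥ 1`):
`e_k(x) = π^{−1/4} ((k−1)!)^{−1/2} e^{−x²/2} h_{k−1}(√2 x)`. -/
def hermiteFun (k : ℕ) (x : ℝ) : ℝ :=
  Real.pi ^ (-(1/4) : ℝ) * ((Nat.factorial (k - 1) : ℝ)) ^ (-(1/2) : ℝ) *
    Real.exp (-(x^2) / 2) * hermiteP (k - 1) (Real.sqrt 2 * x)

/-- The set `𝒥` of multi-indices: finitely supported functions from `{1,2,…}` (here indexed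
by `ℕ`, index `j` standing for `j+1`) to the nonnegative integers. -/
abbrev MultiIndex := ℕ →₀ ℕ

/-- `α! = Π_j α_j!` for a multi-index `α`. -/
def mfact (α : MultiIndex) : ℝ :=
  α.prod fun _ n => (Nat.factorial n : ℝ)

/-- `H_α(ω) = Π_j h_{α_j}(⟨ω, e_j⟩)`, a finite product since `α` is finitely supported;
here `e : ℕ → 𝒮(ℝ)` is a family with `e k` equal (as a function) to the `k`-th Hermite
function, and index `j : ℕ` of the finsupp stands for the integer `j + 1`. -/
def Hmulti (e : ℕ → SchwartzR) (α : MultiIndex) (ω : TemperedDistR) : ℝ :=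
  α.prod fun j n => hermiteP n (ω (e (j + 1)))

theorem SchwartzMap.norm_le_integral_norm_deriv (f : SchwartzR) (x : ℝ) :
    ‖f x‖ ≤ ∫ y, ‖deriv f y‖ := by
  have hint : Integrable (fun y => deriv f y) :=
    (SchwartzMap.derivCLM ℝ ℝ f).integrable (μ := volume)
  have hbot : Filter.Tendsto f Filter.atBot (nhds 0) :=
    (zero_at_infty f).mono_left _root_.atBot_le_cocompact
  have h := integral_Iic_of_hasDerivAt_of_tendsto' (a := x)
    (fun y _ => f.differentiableAt.hasDerivAt) hint.integrableOn hbot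
  rw [sub_zero] at h
  rw [← h]
  exact (norm_integral_le_integral_norm _).trans
    (setIntegral_le_integral hint.norm (Filter.Eventually.of_forall fun _ => norm_nonneg _))

/-- The map `f ↦ xᵏ f⁽ⁿ⁾` on the Schwartz space. -/
def SchwartzMap.powMulIteratedDeriv (k n : ℕ) : SchwartzR →L[ℝ] SchwartzR :=
  (SchwartzMap.smulLeftCLM ℝ (fun x : ℝ => x ^ k)).comp ((SchwartzMap.derivCLM ℝ ℝ) ^ n)

theorem SchwartzMap.derivCLM_pow_apply (n : ℕ) (f : SchwartzR) (x : ℝ) :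
    ((SchwartzMap.derivCLM ℝ ℝ) ^ n) f x = iteratedDeriv n f x := by
  induction n generalizing x with
  | zero => simp
  | succ n ih =>
    rw [pow_succ', mul_apply_eq_comp, SchwartzMap.derivCLM_apply, iteratedDeriv_succ,
      funext ih]

theorem SchwartzMap.powMulIteratedDeriv_apply (k n : ℕ) (f : SchwartzR) (x : ℝ) :
    SchwartzMap.powMulIteratedDeriv k n f x = x ^ k * iteratedDeriv n f x := by
  have hg : (fun x : ℝ => x ^ k).HasTemperateGrowth := by fun_prop
  rw [powMulIteratedDeriv, ContinuousLinearMap.comp_apply, SchwartzMap.smulLeftCLM_apply_apply hg,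
    derivCLM_pow_apply, smul_eq_mul]

/-- The map `f ↦ (xᵏ f⁽ⁿ⁾)'` from the Schwartz space to `L¹`. -/
def SchwartzMap.derivPowMulToLp (i : ℕ × ℕ) : SchwartzR →L[ℝ] Lp ℝ 1 (volume : Measure ℝ) :=
  (SchwartzMap.toLpCLM ℝ ℝ 1 volume).comp
    ((SchwartzMap.derivCLM ℝ ℝ).comp (SchwartzMap.powMulIteratedDeriv i.1 i.2))

theorem SchwartzMap.seminormFamily_le_norm_derivPowMulToLp (i : ℕ × ℕ) (f : SchwartzR) :
    schwartzSeminormFamily ℝ ℝ ℝ i f ≤ ‖SchwartzMap.derivPowMulToLp i f‖ := by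
  refine SchwartzMap.seminorm_le_bound' ℝ _ _ f (norm_nonneg _) fun x => ?_
  have h := SchwartzMap.norm_le_integral_norm_deriv (powMulIteratedDeriv i.1 i.2 f) x
  rw [powMulIteratedDeriv_apply, norm_mul, norm_pow, Real.norm_eq_abs] at h
  refine h.trans_eq ?_
  simp only [derivPowMulToLp, ContinuousLinearMap.comp_apply, SchwartzMap.toLpCLM_apply,
    SchwartzMap.norm_toLp_one, SchwartzMap.derivCLM_apply]

instance SchwartzMap.secondCountableTopology_real : SecondCountableTopology SchwartzR := by
  have : IsSeparable (volume : Measure ℝ) := inferInstance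
  have : Fact ((1 : ENNReal) ≠ ⊤) := ⟨ENNReal.one_ne_top⟩
  let T : SchwartzR → (ℕ × ℕ → Lp ℝ 1 (volume : Measure ℝ)) := fun f i => derivPowMulToLp i f
  have hT : Topology.IsInducing T := by
    rw [Topology.isInducing_iff_nhds]
    intro f
    refine le_antisymm ?_ ?_
    · exact (continuous_pi fun i => (derivPowMulToLp i).continuous).continuousAt.tendsto.le_comap
    · suffices h : Filter.Tendsto id (Filter.comap T (nhds (T f))) (nhds f) from h
      refine ((schwartz_withSeminorms ℝ ℝ ℝ).tendsto_nhds id f).2 fun i ε hε => ?_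
      have hi : Filter.Tendsto (fun g => T g i) (Filter.comap T (nhds (T f))) (nhds (T f i)) :=
        ((continuous_apply i).tendsto (T f)).comp (Filter.tendsto_comap (f := T))
      filter_upwards [Metric.tendsto_nhds.1 hi ε hε] with g hg
      refine (seminormFamily_le_norm_derivPowMulToLp i _).trans_lt ?_
      rwa [id, map_sub, ← dist_eq_norm]
  exact hT.secondCountableTopology

/-- In the weak-* topology on the dual of a second countable topological vector space, the Borel
σ-algebra is generated by the evaluations. -/
theorem WeakDual.borel_eq_comap_eval {E : Type*} [AddCommGroup E] [Module ℝ E] [TopologicalSpace E]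
    [IsTopologicalAddGroup E] [ContinuousConstSMul ℝ E] [SecondCountableTopology E] :
    borel (WeakDual ℝ E) =
      MeasurableSpace.comap (fun (ω : WeakDual ℝ E) (φ : E) => ω φ) MeasurableSpace.pi := by
  obtain ⟨V, hV⟩ := (nhds (0 : E)).exists_antitone_basis
  let K : ℕ → Set (WeakDual ℝ E) := fun n => {ω | ∀ φ ∈ V n, |ω φ| ≤ 1}
  have hK : ⋃ n, K n = Set.univ := by
    refine Set.eq_univ_of_forall fun ω => ?_
    have h0 : {φ : E | |ω φ| ≤ 1} ∈ nhds (0 : E) := by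
      have hc : Continuous fun φ : E => |ω φ| := (map_continuous ω).abs
      refine hc.continuousAt.preimage_mem_nhds (Iic_mem_nhds ?_)
      simp
    obtain ⟨n, -, hn⟩ := hV.1.mem_iff.1 h0
    exact Set.mem_iUnion.2 ⟨n, fun φ hφ => hn hφ⟩
  obtain ⟨D, hDc, hD⟩ := TopologicalSpace.exists_countable_dense E
  have hKsc : ∀ n, SecondCountableTopology (K n) := by
    intro n
    have : Countable D := hDc
    let R : K n → (D → ℝ) := fun ω d => ω.1 d.1
    suffices hR : Topology.IsInducing R from hR.secondCountableTopology
    have hev : ∀ φ : E, Continuous fun ω : WeakDual ℝ E => ω φ := WeakDual.eval_continuous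
    refine ⟨le_antisymm ?_ ?_⟩
    · exact continuous_iff_le_induced.1
        (continuous_pi fun d => (hev d.1).comp continuous_subtype_val)
    · let τ : TopologicalSpace (K n) := TopologicalSpace.induced R inferInstance
      change τ ≤ _
      rw [← continuous_id_iff_le, continuous_induced_rng]
      refine WeakDual.continuous_of_continuous_eval fun φ => ?_
      refine @continuous_of_uniform_approx_of_continuous _ _ τ _ _ fun u hu => ?_
      obtain ⟨ε, hε, hεu⟩ := Metric.mem_uniformity_dist.1 hu
      have hnhd : {ψ : E | (ε / 2)⁻¹ • (φ - ψ) ∈ V n} ∈ nhds φ := by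
        have hc : Continuous fun ψ : E => (ε / 2)⁻¹ • (φ - ψ) :=
          (continuous_const.sub continuous_id).const_smul _
        refine hc.continuousAt.preimage_mem_nhds ?_
        simpa using hV.1.mem_of_mem (i := n) trivial
      obtain ⟨d, hdD, hd⟩ := hD.inter_nhds_nonempty hnhd
      have hRd : @Continuous _ _ τ _ fun ω => R ω ⟨d, hdD⟩ :=
        (continuous_apply (⟨d, hdD⟩ : D)).comp (continuous_induced_dom (f := R))
      refine ⟨_, hRd, fun ω => ?_⟩
      refine hεu ?_
      have h1 := ω.2 _ hd
      rw [map_smul, map_sub, smul_eq_mul, abs_mul, abs_inv, abs_of_pos (half_pos hε),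
        inv_mul_le_iff₀ (half_pos hε), mul_one] at h1
      exact (Real.dist_eq _ _).trans_lt (h1.trans_lt (half_lt_self hε))
  have hHL : HereditarilyLindelofSpace (WeakDual ℝ E) := by
    refine HereditarilyLindelofSpace.of_forall_isOpen fun s _ => ?_
    have hs : s = ⋃ n, Subtype.val '' (Subtype.val ⁻¹' s : Set (K n)) := by
      simp_rw [Subtype.image_preimage_coe, ← Set.iUnion_inter, hK, Set.univ_inter]
    rw [hs]
    exact isLindelof_iUnion fun n =>
      (HereditarilyLindelofSpace.isLindelof _).image continuous_subtype_val
  let ev : WeakDual ℝ E → (E → ℝ) := fun ω φ => ω φ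
  have hev : Continuous ev := continuous_pi WeakDual.eval_continuous
  refine le_antisymm (MeasurableSpace.generateFrom_le fun U hU => ?_) ?_
  · obtain ⟨W, hW, rfl⟩ : ∃ W : Set (E → ℝ), IsOpen W ∧ ev ⁻¹' W = U := isOpen_induced_iff.1 hU
    have hbox : ∀ ω : WeakDual ℝ E, ∃ B : Set (E → ℝ), IsOpen B ∧ MeasurableSet B ∧
        (ω ∈ ev ⁻¹' W → ω ∈ ev ⁻¹' B) ∧ B ⊆ W := by
      intro ω
      by_cases hω : ω ∈ ev ⁻¹' W
      · obtain ⟨I, u, hu, hIW⟩ := isOpen_pi_iff.1 hW _ hω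
        exact ⟨(I : Set E).pi u, isOpen_set_pi I.finite_toSet fun a ha => (hu a ha).1,
          MeasurableSet.pi I.countable_toSet fun a ha => (hu a ha).1.measurableSet,
          fun _ a ha => (hu a ha).2, hIW⟩
      · exact ⟨∅, isOpen_empty, MeasurableSet.empty, fun h => absurd h hω, Set.empty_subset _⟩
    choose B hBo hBm hBmem hBW using hbox
    obtain ⟨t, htc, -, ht⟩ := (HereditarilyLindelofSpace.isLindelof (ev ⁻¹' W)).elim_nhds_subcover
      (fun ω => ev ⁻¹' B ω) fun ω hω => ((hBo ω).preimage hev).mem_nhds (hBmem ω hω)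
    have hUt : ev ⁻¹' W = ⋃ ω ∈ t, ev ⁻¹' B ω :=
      ht.antisymm (Set.iUnion₂_subset fun ω _ => Set.preimage_mono (hBW ω))
    rw [hUt]
    exact @MeasurableSet.biUnion _ _ (MeasurableSpace.comap ev MeasurableSpace.pi) _ _ htc
      fun ω _ => ⟨B ω, hBm ω, rfl⟩
  · borelize (WeakDual ℝ E)
    exact (measurable_pi_lambda _ fun φ => (WeakDual.eval_continuous φ).measurable).comap_le

/-- If `g` is orthogonal to all powers of `Z` and `g e^{|Z|}` is integrable, then `g` is orthogonal
to `e^{iZ}`. -/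
theorem integral_mul_cexp_eq_zero_of_integral_mul_pow_eq_zero {Ω : Type*} [MeasurableSpace Ω]
    {μ : Measure Ω} {g Z : Ω → ℝ} (hg : AEStronglyMeasurable g μ) (hZ : AEStronglyMeasurable Z μ)
    (hgZ : Integrable (fun ω => g ω * Real.exp |Z ω|) μ) (h : ∀ n : ℕ, ∫ ω, g ω * Z ω ^ n ∂μ = 0) :
    ∫ ω, (g ω : ℂ) * Complex.exp (Complex.I * (Z ω : ℂ)) ∂μ = 0 := by
  have hexp : ∀ x : ℝ, HasSum (fun n : ℕ => x ^ n / n.factorial) (Real.exp x) := fun x => by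
    rw [Real.exp_eq_exp_ℝ]; exact NormedSpace.expSeries_div_hasSum_exp x
  have hcexp : ∀ x : ℂ, HasSum (fun n : ℕ => x ^ n / n.factorial) (Complex.exp x) := fun x => by
    rw [Complex.exp_eq_exp_ℂ]; exact NormedSpace.expSeries_div_hasSum_exp x
  have hbd : ∀ ω, HasSum (fun n : ℕ => |g ω| * (|Z ω| ^ n / n.factorial))
      (|g ω| * Real.exp |Z ω|) := fun ω => (hexp _).mul_left _
  have key := hasSum_integral_of_dominated_convergence (μ := μ)
    (F := fun (n : ℕ) ω => (g ω : ℂ) * ((Complex.I * (Z ω : ℂ)) ^ n / n.factorial))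
    (f := fun ω => (g ω : ℂ) * Complex.exp (Complex.I * (Z ω : ℂ)))
    (fun (n : ℕ) ω => |g ω| * (|Z ω| ^ n / n.factorial)) ?_ ?_ ?_ ?_ ?_
  · refine key.unique ?_
    have h0 : ∀ n : ℕ, ∫ ω, (g ω : ℂ) * ((Complex.I * (Z ω : ℂ)) ^ n / n.factorial) ∂μ = 0 := by
      intro n
      have h1 : ∀ ω, (g ω : ℂ) * ((Complex.I * (Z ω : ℂ)) ^ n / n.factorial)
          = (Complex.I ^ n / n.factorial) * ((g ω * Z ω ^ n : ℝ) : ℂ) := fun ω => by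
        push_cast; ring
      simp_rw [h1]
      rw [integral_const_mul, integral_complex_ofReal, h n, Complex.ofReal_zero, mul_zero]
    simp_rw [h0]
    exact hasSum_zero
  · exact fun n => by fun_prop
  · refine fun n => Filter.Eventually.of_forall fun ω => le_of_eq ?_
    simp
  · exact Filter.Eventually.of_forall fun ω => (hbd ω).summable
  · simp_rw [fun ω => (hbd ω).tsum_eq]
    refine hgZ.norm.congr (Filter.Eventually.of_forall fun ω => ?_)
    simp
  · exact Filter.Eventually.of_forall fun ω => (hcexp _).mul_left _

theorem charFunDual_map_eval {Ω E ι : Type*} [MeasurableSpace Ω] [AddCommGroup E] [Module ℝ E]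
    [Fintype ι] [DecidableEq ι] (ν : Measure Ω) (Y : Ω → E →ₗ[ℝ] ℝ)
    (hY : ∀ φ, Measurable fun ω => Y ω φ) (v : ι → E) (L : StrongDual ℝ (ι → ℝ)) :
    charFunDual (ν.map fun ω i => Y ω (v i)) L =
      ∫ ω, Complex.exp (Complex.I * (Y ω (∑ i, L (Pi.single i 1) • v i) : ℂ)) ∂ν := by
  rw [charFunDual_apply, integral_map (measurable_pi_lambda _ fun i => hY (v i)).aemeasurable
    (by fun_prop)]
  refine integral_congr_ae (Filter.Eventually.of_forall fun ω => ?_)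
  have h : L (fun i => Y ω (v i)) = Y ω (∑ i, L (Pi.single i 1) • v i) := by
    conv_lhs => rw [← Finset.univ_sum_single (fun i => Y ω (v i))]
    simp only [map_sum, map_smul, smul_eq_mul]
    refine Finset.sum_congr rfl fun i _ => ?_
    rw [mul_comm, ← smul_eq_mul, ← map_smul, ← Pi.single_smul, smul_eq_mul, mul_one]
  simp only [h, mul_comm]

/-- On a space whose σ-algebra is generated by a linear family of real functions, a finite measure
is determined by its characteristic functional. -/
theorem Measure.ext_of_integral_cexp_eval {Ω E : Type*} [m : MeasurableSpace Ω] [AddCommGroup E]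
    [Module ℝ E] {Y : Ω → E →ₗ[ℝ] ℝ}
    (hm : m = MeasurableSpace.comap (fun ω φ => Y ω φ) MeasurableSpace.pi)
    {ν ν' : Measure Ω} [IsFiniteMeasure ν] [IsFiniteMeasure ν']
    (h : ∀ φ, ∫ ω, Complex.exp (Complex.I * (Y ω φ : ℂ)) ∂ν =
      ∫ ω, Complex.exp (Complex.I * (Y ω φ : ℂ)) ∂ν') : ν = ν' := by
  classical
  have hev : Measurable fun ω φ => Y ω φ := by
    rw [hm]; exact comap_measurable _
  have hY : ∀ φ, Measurable fun ω => Y ω φ := fun φ => (measurable_pi_apply φ).comp hev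
  have hmap : ν.map (fun ω φ => Y ω φ) = ν'.map fun ω φ => Y ω φ := by
    refine IsProjectiveLimit.unique (P := fun I => (ν.map fun ω φ => Y ω φ).map I.restrict)
      (fun I => rfl) fun I => ?_
    have hr : Measurable (I.restrict : (E → ℝ) → (I → ℝ)) := Finset.measurable_restrict I
    beta_reduce
    rw [Measure.map_map hr hev, Measure.map_map hr hev]
    refine Measure.ext_of_charFunDual (funext fun L => ?_)
    exact (charFunDual_map_eval ν' Y hY (fun i : I => i.1) L).trans
      ((h _).symm.trans (charFunDual_map_eval ν Y hY (fun i : I => i.1) L).symm)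
  refine Measure.ext fun s hs => ?_
  have hs' : MeasurableSet[MeasurableSpace.comap (fun ω φ => Y ω φ) MeasurableSpace.pi] s := by
    rwa [← hm]
  obtain ⟨t, ht, rfl⟩ := hs'
  rw [← Measure.map_apply hev ht, ← Measure.map_apply hev ht, hmap]

theorem ae_eq_zero_of_integral_mul_cexp_eval {Ω E : Type*} [m : MeasurableSpace Ω] [AddCommGroup E]
    [Module ℝ E] {Y : Ω → E →ₗ[ℝ] ℝ}
    (hm : m = MeasurableSpace.comap (fun ω φ => Y ω φ) MeasurableSpace.pi)
    {μ : Measure Ω} {g : Ω → ℝ} (hg : Integrable g μ)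
    (h : ∀ φ, ∫ ω, (g ω : ℂ) * Complex.exp (Complex.I * (Y ω φ : ℂ)) ∂μ = 0) : g =ᵐ[μ] 0 := by
  have hev : Measurable fun ω φ => Y ω φ := by
    rw [hm]; exact comap_measurable _
  have hY : ∀ φ, Measurable fun ω => Y ω φ := fun φ => (measurable_pi_apply φ).comp hev
  have hfin : ∀ f : Ω → ℝ, Integrable f μ →
      IsFiniteMeasure (μ.withDensity fun ω => ENNReal.ofReal (f ω)) := fun f hf =>
    isFiniteMeasure_withDensity_ofReal hf.2
  have hint : ∀ f : Ω → ℝ, Integrable f μ → ∀ φ,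
      ∫ ω, Complex.exp (Complex.I * (Y ω φ : ℂ)) ∂(μ.withDensity fun ω => ENNReal.ofReal (f ω)) =
        ∫ ω, ((max (f ω) 0 : ℝ) : ℂ) * Complex.exp (Complex.I * (Y ω φ : ℂ)) ∂μ := by
    intro f hf φ
    rw [integral_withDensity_eq_integral_toReal_smul₀ hf.aemeasurable.ennreal_ofReal
      (Filter.Eventually.of_forall fun _ => ENNReal.ofReal_lt_top)]
    simp [ENNReal.toReal_ofReal']
  have := hfin g hg
  have := hfin (-g) hg.neg
  have hint' : ∀ f : Ω → ℝ, Integrable f μ → ∀ φ, Integrable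
      (fun ω => ((max (f ω) 0 : ℝ) : ℂ) * Complex.exp (Complex.I * (Y ω φ : ℂ))) μ := by
    intro f hf φ
    refine hf.pos_part.ofReal.mul_bdd (c := 1) ?_ ?_
    · have := hY φ
      fun_prop
    · refine Filter.Eventually.of_forall fun ω => ?_
      rw [mul_comm, Complex.norm_exp_ofReal_mul_I]
  have heq : (μ.withDensity fun ω => ENNReal.ofReal (g ω)) =
      μ.withDensity fun ω => ENNReal.ofReal ((-g) ω) := by
    refine Measure.ext_of_integral_cexp_eval hm fun φ => ?_
    rw [hint g hg, hint (-g) hg.neg, ← sub_eq_zero, ← integral_sub (hint' g hg φ)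
      (hint' (-g) hg.neg φ), ← h φ]
    refine integral_congr_ae (Filter.Eventually.of_forall fun ω => ?_)
    simp only [← sub_mul, ← Complex.ofReal_sub, Pi.neg_apply]
    congr 2
    rcases le_total (g ω) 0 with h0 | h0
    · rw [max_eq_right h0, max_eq_left (neg_nonneg.2 h0)]; ring
    · rw [max_eq_left h0, max_eq_right (neg_nonpos.2 h0)]; ring
  have hae := (withDensity_eq_iff hg.aemeasurable.ennreal_ofReal
    hg.neg.aemeasurable.ennreal_ofReal hg.lintegral_lt_top.ne).1 heq
  filter_upwards [hae] with ω hω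
  have h1 := congrArg ENNReal.toReal hω
  simp only [ENNReal.toReal_ofReal', Pi.neg_apply] at h1
  rcases le_total (g ω) 0 with h0 | h0
  · rw [max_eq_right h0, max_eq_left (neg_nonneg.2 h0)] at h1; simpa using h1.symm
  · rw [max_eq_left h0, max_eq_right (neg_nonpos.2 h0)] at h1; simpa using h1

section Hermite

open Polynomial ProbabilityTheory

theorem hermiteP_eq_aeval (n : ℕ) (x : ℝ) : hermiteP n x = aeval x (hermite n) := by
  rw [Polynomial.hermite_eq_deriv_gaussian', hermiteP, iteratedDeriv_eq_iterate]
  simp only [neg_div]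
  ring

theorem Polynomial.derivative_hermite_succ (n : ℕ) :
    derivative (hermite (n + 1)) = (n + 1 : ℤ[X]) * hermite n := by
  induction n with
  | zero => simp
  | succ n ih =>
    have h := Polynomial.hermite_succ n
    rw [Polynomial.hermite_succ (n + 1), ih]
    simp only [derivative_sub, derivative_mul, derivative_X, derivative_add, derivative_one,
      derivative_natCast]
    rw [ih]
    push_cast
    linear_combination -(n + 1 : ℤ[X]) * h

theorem hermiteP_zero (x : ℝ) : hermiteP 0 x = 1 := by simp [hermiteP_eq_aeval]

theorem mul_hermiteP_zero (x : ℝ) : x * hermiteP 0 x = hermiteP 1 x := by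
  simp [hermiteP_eq_aeval]

theorem mul_hermiteP_succ (n : ℕ) (x : ℝ) :
    x * hermiteP (n + 1) x = hermiteP (n + 2) x + (n + 1) * hermiteP n x := by
  simp only [hermiteP_eq_aeval]
  rw [Polynomial.hermite_succ (n + 1), Polynomial.derivative_hermite_succ]
  simp

/-- `x hₙ(x) = hₙ₊₁(x) + n hₙ₋₁(x)`. -/
theorem mul_hermiteP (n : ℕ) (x : ℝ) :
    x * hermiteP n x = hermiteP (n + 1) x + n * hermiteP (n - 1) x := by
  cases n with
  | zero => simp [mul_hermiteP_zero]
  | succ n => simp [mul_hermiteP_succ]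

theorem continuous_hermiteP (n : ℕ) : Continuous (hermiteP n) := by
  simp only [funext (hermiteP_eq_aeval n)]
  fun_prop

theorem integrable_eval_gaussianReal (p : ℝ[X]) (m : ℝ) (v : NNReal) :
    Integrable (fun x => p.eval x) (gaussianReal m v) := by
  have h : ∀ n : ℕ, Integrable (fun x : ℝ => x ^ n) (gaussianReal m v) := fun n =>
    ((memLp_id_gaussianReal' (n : ENNReal) (by simp)).integrable_norm_pow').mono'
      (by fun_prop) (Filter.Eventually.of_forall fun x => by simp)
  simp only [Polynomial.eval_eq_sum]
  exact integrable_finsetSum _ fun n _ => (h n).const_mul _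

/-- Gaussian integration by parts for polynomials. -/
theorem integral_derivative_gaussianReal (p : ℝ[X]) :
    ∫ x, (derivative p).eval x ∂(gaussianReal 0 1) = ∫ x, x * p.eval x ∂(gaussianReal 0 1) := by
  have hpdf : ∀ x : ℝ, HasDerivAt (gaussianPDFReal 0 1) (-x * gaussianPDFReal 0 1 x) x := by
    intro x
    have h1 : HasDerivAt (fun y : ℝ => -(y - 0) ^ 2 / (2 * ((1 : NNReal) : ℝ))) (-x) x := by
      have := ((hasDerivAt_id x).pow 2).neg.div_const 2
      refine (this.congr_deriv ?_).congr_of_eventuallyEq (Filter.Eventually.of_forall fun y => ?_)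
      · simp; ring
      · simp
    refine (h1.exp.const_mul (Real.sqrt (2 * Real.pi * ((1 : NNReal) : ℝ)))⁻¹).congr_deriv ?_
    simp only [gaussianPDFReal]
    ring
  have hint : ∀ q : ℝ[X], Integrable (fun x => gaussianPDFReal 0 1 x * q.eval x) := by
    intro q
    have := integrable_eval_gaussianReal q 0 1
    rw [gaussianReal_of_var_ne_zero _ one_ne_zero, integrable_withDensity_iff
      (measurable_gaussianPDF _ _) (Filter.Eventually.of_forall fun _ => gaussianPDF_lt_top)] at this
    refine this.congr (Filter.Eventually.of_forall fun x => ?_)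
    simp [toReal_gaussianPDF, mul_comm]
  have hz := integral_eq_zero_of_hasDerivAt_of_integrable
    (f := fun x => gaussianPDFReal 0 1 x * p.eval x)
    (f' := fun x => gaussianPDFReal 0 1 x * (derivative p - X * p).eval x)
    (fun x => by
      refine ((hpdf x).mul (p.hasDerivAt x)).congr_deriv ?_
      simp; ring) (hint _) (hint p)
  simp only [integral_gaussianReal_eq_integral_smul (one_ne_zero : (1 : NNReal) ≠ 0), smul_eq_mul]
  have hX : Integrable fun x => gaussianPDFReal 0 1 x * (x * p.eval x) :=
    (hint (X * p)).congr (Filter.Eventually.of_forall fun x => by simp)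
  rw [← sub_eq_zero, ← integral_sub (hint _) hX]
  refine Eq.trans (integral_congr_ae (Filter.Eventually.of_forall fun x => ?_)) hz
  simp only [eval_sub, eval_mul, eval_X]
  ring

theorem hermiteP_eq_eval (n : ℕ) (x : ℝ) :
    hermiteP n x = ((hermite n).map (Int.castRingHom ℝ)).eval x := by
  rw [hermiteP_eq_aeval, aeval_def, eval_map]; rfl

theorem integrable_hermiteP_mul_gaussianReal (m n : ℕ) :
    Integrable (fun x => hermiteP m x * hermiteP n x) (gaussianReal 0 1) := by
  simp only [hermiteP_eq_eval, ← eval_mul]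
  exact integrable_eval_gaussianReal _ _ _

theorem integral_hermiteP_succ_mul_gaussianReal (m : ℕ) (p : ℝ[X]) :
    ∫ x, hermiteP (m + 1) x * p.eval x ∂(gaussianReal 0 1) =
      ∫ x, hermiteP m x * (derivative p).eval x ∂(gaussianReal 0 1) := by
  set q := (hermite m).map (Int.castRingHom ℝ) with hq
  have h := integral_derivative_gaussianReal (q * p)
  have h1 : (hermite (m + 1)).map (Int.castRingHom ℝ) = X * q - derivative q := by
    rw [hermite_succ, Polynomial.map_sub, Polynomial.map_mul, derivative_map]; simp [hq]
  simp only [hermiteP_eq_eval, ← hq, h1]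
  have e1 : ∀ x : ℝ, (X * q - derivative q).eval x * p.eval x =
      x * (q * p).eval x - (derivative q * p).eval x := fun x => by simp; ring
  have e2 : ∀ x : ℝ, q.eval x * (derivative p).eval x =
      (derivative (q * p)).eval x - (derivative q * p).eval x := fun x => by simp [derivative_mul]
  simp only [e1, e2]
  rw [integral_sub, integral_sub, h]
  · exact integrable_eval_gaussianReal _ _ _
  · exact integrable_eval_gaussianReal _ _ _
  · exact (integrable_eval_gaussianReal (X * (q * p)) 0 1).congr
      (Filter.Eventually.of_forall fun x => by simp)
  · exact integrable_eval_gaussianReal _ _ _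

/-- The Hermite polynomials are orthogonal for the standard Gaussian measure. -/
theorem integral_hermiteP_mul_gaussianReal (m n : ℕ) :
    ∫ x, hermiteP m x * hermiteP n x ∂(gaussianReal 0 1) =
      if m = n then (n.factorial : ℝ) else 0 := by
  have hs : ∀ m n : ℕ, ∫ x, hermiteP (m + 1) x * hermiteP n x ∂(gaussianReal 0 1) =
      n * ∫ x, hermiteP m x * hermiteP (n - 1) x ∂(gaussianReal 0 1) := by
    intro m n
    simp only [hermiteP_eq_eval n]
    rw [integral_hermiteP_succ_mul_gaussianReal, ← integral_const_mul]
    refine integral_congr_ae (Filter.Eventually.of_forall fun x => ?_)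
    cases n with
    | zero => simp
    | succ n =>
      simp only [derivative_map, derivative_hermite_succ, hermiteP_eq_eval]
      simp
      ring
  induction m generalizing n with
  | zero =>
    cases n with
    | zero => simp [hermiteP_zero]
    | succ n =>
      simp_rw [mul_comm (hermiteP 0 _)]
      rw [hs]; simp
  | succ m ih =>
    rw [hs]
    cases n with
    | zero => simp
    | succ n => simp [ih, Nat.factorial_succ]

end Hermite

theorem integral_hermiteFun_mul (j k : ℕ) :
    ∫ x, hermiteFun (j + 1) x * hermiteFun (k + 1) x = if j = k then 1 else 0 := by
  set G : ℝ → ℝ := fun y => Real.exp (-(y ^ 2) / 2) * (hermiteP j y * hermiteP k y) with hG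
  have hγ : ∫ y, G y = Real.sqrt (2 * Real.pi) * if j = k then (k.factorial : ℝ) else 0 := by
    rw [← integral_hermiteP_mul_gaussianReal, ProbabilityTheory.integral_gaussianReal_eq_integral_smul
      (one_ne_zero : (1 : NNReal) ≠ 0), ← integral_const_mul]
    refine integral_congr_ae (Filter.Eventually.of_forall fun x => ?_)
    simp only [hG, ProbabilityTheory.gaussianPDFReal, NNReal.coe_one, mul_one, sub_zero, smul_eq_mul]
    have : Real.sqrt (2 * Real.pi) ≠ 0 := by positivity
    field_simp
  have hfac : ∀ n : ℕ, (n.factorial : ℝ) ^ (-(1/2) : ℝ) * (n.factorial : ℝ) ^ (-(1/2) : ℝ) *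
      n.factorial = 1 := fun n => by
    have : (0 : ℝ) < n.factorial := by positivity
    rw [← Real.rpow_add this, ← Real.rpow_add_one this.ne']
    norm_num
  have hpi : Real.pi ^ (-(1/4) : ℝ) * Real.pi ^ (-(1/4) : ℝ) * Real.sqrt Real.pi = 1 := by
    rw [Real.sqrt_eq_rpow, ← Real.rpow_add Real.pi_pos, ← Real.rpow_add Real.pi_pos]
    norm_num
  have hprod : ∀ x, hermiteFun (j + 1) x * hermiteFun (k + 1) x =
      (Real.pi ^ (-(1/4) : ℝ) * Real.pi ^ (-(1/4) : ℝ) * (j.factorial : ℝ) ^ (-(1/2) : ℝ) *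
        (k.factorial : ℝ) ^ (-(1/2) : ℝ)) * G (Real.sqrt 2 * x) := by
    intro x
    have : Real.exp (-(Real.sqrt 2 * x) ^ 2 / 2) = Real.exp (-(x^2) / 2) * Real.exp (-(x^2) / 2) := by
      rw [← Real.exp_add, mul_pow, Real.sq_sqrt zero_le_two]; ring_nf
    simp only [hG, hermiteFun, Nat.add_sub_cancel, this]
    ring
  simp only [hprod]
  rw [integral_const_mul, Measure.integral_comp_mul_left, hγ, abs_of_pos (by positivity),
    Real.sqrt_mul zero_le_two, smul_eq_mul]
  have h2 : (Real.sqrt 2)⁻¹ * Real.sqrt 2 = 1 := inv_mul_cancel₀ (by positivity)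
  split_ifs with h
  · subst h
    have hmul := congrArg₂ (· * ·) hpi (hfac j)
    beta_reduce at hmul
    linear_combination hmul + (Real.pi ^ (-(1/4) : ℝ) * Real.pi ^ (-(1/4) : ℝ) *
      Real.sqrt Real.pi * ((j.factorial : ℝ) ^ (-(1/2) : ℝ) * (j.factorial : ℝ) ^ (-(1/2) : ℝ) *
      j.factorial)) * h2
  · simp

theorem integrable_and_integral_mul_eq_zero_of_mem_span {Ω : Type*} [MeasurableSpace Ω]
    {μ : Measure Ω} {g : Ω → ℝ} {S : Set (Ω → ℝ)}
    (h : ∀ s ∈ S, Integrable (fun ω => g ω * s ω) μ ∧ ∫ ω, g ω * s ω ∂μ = 0) {w : Ω → ℝ}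
    (hw : w ∈ Submodule.span ℝ S) :
    Integrable (fun ω => g ω * w ω) μ ∧ ∫ ω, g ω * w ω ∂μ = 0 := by
  induction hw using Submodule.span_induction with
  | mem s hs => exact h s hs
  | zero => simp
  | add x y _ _ hx hy =>
    simp only [Pi.add_apply, mul_add]
    exact ⟨hx.1.add hy.1, by rw [integral_add hx.1 hy.1, hx.2, hy.2, add_zero]⟩
  | smul c x _ hx =>
    simp only [Pi.smul_apply, smul_eq_mul, mul_left_comm _ c]
    exact ⟨hx.1.const_mul c, by rw [integral_const_mul, hx.2, mul_zero]⟩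

theorem pow_mem_span_of_mul_mem_span {A : Type*} [CommRing A] [Algebra ℝ A] {S : Set A} {Z : A}
    (h1 : 1 ∈ Submodule.span ℝ S) (hZ : ∀ s ∈ S, Z * s ∈ Submodule.span ℝ S) (n : ℕ) :
    Z ^ n ∈ Submodule.span ℝ S := by
  have hmul : ∀ w ∈ Submodule.span ℝ S, Z * w ∈ Submodule.span ℝ S := by
    intro w hw
    have : Submodule.span ℝ S ≤ (Submodule.span ℝ S).comap (LinearMap.mulLeft ℝ Z) :=
      Submodule.span_le.2 hZ
    exact this hw
  induction n with
  | zero => simpa using h1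
  | succ n ih => rw [pow_succ']; exact hmul _ ih

theorem borel_real_eq_comap_mul :
    (inferInstance : MeasurableSpace ℝ) =
      MeasurableSpace.comap (fun (x ξ : ℝ) => LinearMap.mulLeft ℝ x ξ) MeasurableSpace.pi := by
  refine le_antisymm (fun s hs => ⟨(fun f => f 1) ⁻¹' s, measurable_pi_apply 1 hs, ?_⟩) ?_
  · refine Measurable.comap_le (measurable_pi_lambda _ fun ξ => ?_)
    simp only [LinearMap.mulLeft_apply]
    fun_prop
  · ext; simp

theorem memLp_exp_neg_sq_div_two_mul_exp_abs (ξ : ℝ) :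
    MemLp (fun x : ℝ => Real.exp (-(x ^ 2) / 2) * Real.exp |ξ * x|) 2 := by
  rw [memLp_two_iff_integrable_sq (by fun_prop)]
  refine ((integrable_exp_neg_mul_sq (half_pos one_pos)).const_mul (Real.exp (2 * ξ ^ 2))).mono'
    (by fun_prop) (Filter.Eventually.of_forall fun x => ?_)
  rw [← Real.exp_add, ← Real.exp_add, ← Real.exp_nat_mul, Real.norm_of_nonneg (Real.exp_pos _).le,
    Real.exp_le_exp]
  have h1 := sq_nonneg (|x| / 2 - |ξ|)
  rw [abs_mul]
  have h2 := sq_abs x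
  have h3 := sq_abs ξ
  push_cast
  nlinarith

/-- The Hermite functions are total in `L²(ℝ)`. -/
theorem ae_eq_zero_of_integral_mul_hermiteFun {f : ℝ → ℝ} (hf : MemLp f 2)
    (h : ∀ j : ℕ, ∫ x, f x * hermiteFun (j + 1) x = 0)
    (hi : ∀ j : ℕ, Integrable fun x => f x * hermiteFun (j + 1) x) : f =ᵐ[volume] 0 := by
  set g : ℝ → ℝ := fun x => f x * Real.exp (-(x ^ 2) / 2) with hg
  have hge : ∀ ξ : ℝ, Integrable fun x => g x * Real.exp |ξ * x| := fun ξ =>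
    (hf.integrable_mul (memLp_exp_neg_sq_div_two_mul_exp_abs ξ)).congr
      (Filter.Eventually.of_forall fun x => by simp [hg, mul_assoc])
  have hgi : Integrable g := by simpa using hge 0
  set S : Set (ℝ → ℝ) := Set.range fun (j : ℕ) x => hermiteP j (Real.sqrt 2 * x) with hS
  have hgS : ∀ s ∈ S, Integrable (fun x => g x * s x) ∧ ∫ x, g x * s x = 0 := by
    rintro _ ⟨j, rfl⟩
    have hc : Real.pi ^ (-(1/4) : ℝ) * (j.factorial : ℝ) ^ (-(1/2) : ℝ) ≠ 0 := by positivity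
    have he : ∀ x, g x * hermiteP j (Real.sqrt 2 * x) =
        (Real.pi ^ (-(1/4) : ℝ) * (j.factorial : ℝ) ^ (-(1/2) : ℝ))⁻¹ *
          (f x * hermiteFun (j + 1) x) := fun x => by
      rw [eq_inv_mul_iff_mul_eq₀ hc]
      simp only [hermiteFun, hg, Nat.add_sub_cancel]
      ring
    simp only [he]
    exact ⟨(hi j).const_mul _, by rw [integral_const_mul, h, mul_zero]⟩
  have hpow : ∀ (ξ : ℝ) (n : ℕ), (fun x : ℝ => ξ * x) ^ n ∈ Submodule.span ℝ S := by
    intro ξ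
    refine pow_mem_span_of_mul_mem_span (Submodule.subset_span ⟨0, ?_⟩) ?_
    · ext x; simp [hermiteP_zero]
    · rintro _ ⟨j, rfl⟩
      have : (fun x : ℝ => ξ * x) * (fun x => hermiteP j (Real.sqrt 2 * x)) =
          (ξ / Real.sqrt 2) • ((fun x => hermiteP (j + 1) (Real.sqrt 2 * x)) +
            (j : ℝ) • fun x => hermiteP (j - 1) (Real.sqrt 2 * x)) := by
        ext x
        have h2 : Real.sqrt 2 ≠ 0 := by positivity
        have := mul_hermiteP j (Real.sqrt 2 * x)
        simp only [Pi.mul_apply, Pi.smul_apply, Pi.add_apply, smul_eq_mul, ← this]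
        field_simp
      rw [this]
      exact Submodule.smul_mem _ _ (Submodule.add_mem _ (Submodule.subset_span ⟨_, rfl⟩)
        (Submodule.smul_mem _ _ (Submodule.subset_span ⟨_, rfl⟩)))
  have hg0 : g =ᵐ[volume] 0 := by
    refine ae_eq_zero_of_integral_mul_cexp_eval (Y := fun x => LinearMap.mulLeft ℝ x)
      borel_real_eq_comap_mul hgi fun ξ => ?_
    simp only [LinearMap.mulLeft_apply, mul_comm _ ξ]
    exact integral_mul_cexp_eq_zero_of_integral_mul_pow_eq_zero hgi.1 (by fun_prop) (hge ξ)
      fun n => (integrable_and_integral_mul_eq_zero_of_mem_span hgS (hpow ξ n)).2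
  filter_upwards [hg0] with x hx
  simpa [hg, Real.exp_ne_zero] using hx

theorem SchwartzMap.memLp_two (φ : SchwartzR) : MemLp φ 2 := φ.memLp 2

theorem SchwartzMap.norm_toLp_two_sq (φ : SchwartzR) :
    ‖φ.toLp 2‖ ^ 2 = ∫ x, φ x ^ 2 := by
  rw [← real_inner_self_eq_norm_sq, L2.inner_def]
  refine integral_congr_ae ?_
  filter_upwards [φ.coeFn_toLp 2] with x hx
  rw [hx]; simp [sq]

/-- Every Schwartz function is an `L²`-limit of linear combinations of Hermite functions. -/
theorem exists_seq_span_hermite_tendsto (e : ℕ → SchwartzR)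
    (he : ∀ (k : ℕ) (x : ℝ), e k x = hermiteFun k x) (φ : SchwartzR) :
    ∃ u : ℕ → SchwartzR, (∀ n, u n ∈ Submodule.span ℝ (Set.range fun j => e (j + 1))) ∧
      Filter.Tendsto (fun n => ∫ x, (φ - u n) x ^ 2) Filter.atTop (nhds 0) := by
  set T : SchwartzR →L[ℝ] Lp ℝ 2 (volume : Measure ℝ) := SchwartzMap.toLpCLM ℝ ℝ 2 volume with hT
  set V := (Submodule.span ℝ (Set.range fun j => e (j + 1))).map T.toLinearMap with hV
  have hTop : V.topologicalClosure = ⊤ := by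
    rw [Submodule.topologicalClosure_eq_top_iff, Submodule.eq_bot_iff]
    intro f hf
    have hfe : ∀ j, inner ℝ (T (e (j + 1))) f = 0 := fun j =>
      hf _ (Submodule.mem_map_of_mem (Submodule.subset_span ⟨j, rfl⟩))
    have hcongr : ∀ j, (fun x => inner ℝ (T (e (j + 1)) x) (f x)) =ᵐ[volume]
        fun x => f x * hermiteFun (j + 1) x := fun j => by
      filter_upwards [(e (j + 1)).coeFn_toLp 2] with x hx
      rw [hT, SchwartzMap.toLpCLM_apply, hx]
      simp [he]
    refine Lp.ext ((ae_eq_zero_of_integral_mul_hermiteFun (Lp.memLp f) (fun j => ?_)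
      fun j => ?_).trans (Lp.coeFn_zero _ _ _).symm)
    · rw [← integral_congr_ae (hcongr j), ← L2.inner_def, hfe]
    · exact (L2.integrable_inner (T (e (j + 1))) f).congr (hcongr j)
  have hmem : T φ ∈ closure (V : Set (Lp ℝ 2 (volume : Measure ℝ))) := by
    rw [← Submodule.topologicalClosure_coe, hTop]; trivial
  obtain ⟨x, hxV, hx⟩ := mem_closure_iff_seq_limit.1 hmem
  choose u hu hux using hxV
  refine ⟨u, hu, ?_⟩
  have h1 : Filter.Tendsto (fun n => ‖T φ - x n‖ ^ 2) Filter.atTop (nhds 0) := by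
    have := ((tendsto_const_nhds (x := T φ)).sub hx).norm.pow 2
    simpa using this
  refine h1.congr fun n => ?_
  rw [← hux n, ContinuousLinearMap.coe_coe, ← map_sub, ← SchwartzMap.norm_toLp_two_sq]
  rfl

section WhiteNoise

open ProbabilityTheory

/-- A tempered distribution as a plain linear functional. -/
def TemperedDistR.toLinearMap (ω : TemperedDistR) : SchwartzR →ₗ[ℝ] ℝ where
  toFun φ := ω φ
  map_add' := map_add ω
  map_smul' := map_smul ω

theorem TemperedDistR.measurableSpace_eq_comap :
    (inferInstance : MeasurableSpace TemperedDistR) =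
      MeasurableSpace.comap (fun ω φ => TemperedDistR.toLinearMap ω φ) MeasurableSpace.pi :=
  WeakDual.borel_eq_comap_eval

theorem TemperedDistR.measurable_eval (φ : SchwartzR) :
    Measurable fun ω : TemperedDistR => ω φ := by
  have : BorelSpace TemperedDistR := ⟨rfl⟩
  exact (WeakDual.eval_continuous φ).measurable

/-- The defining property of a white noise measure. -/
def IsWhiteNoise (P : Measure TemperedDistR) : Prop :=
  ∀ φ : SchwartzR, ∫ ω, Complex.exp (Complex.I * ((ω φ : ℝ) : ℂ)) ∂P
    = Complex.exp (-(1/2) * ((∫ x, (φ x)^2 : ℝ) : ℂ))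

theorem SchwartzMap.integrable_mul_real (φ ψ : SchwartzR) : Integrable fun x => φ x * ψ x :=
  φ.memLp_two.integrable_mul ψ.memLp_two

theorem charFunDual_gaussianReal_zero_one (L : StrongDual ℝ ℝ) :
    charFunDual (gaussianReal 0 1) L = Complex.exp (-(1/2) * ((L 1 ^ 2 : ℝ) : ℂ)) := by
  have h : charFunDual (gaussianReal 0 1) L = charFun (gaussianReal 0 1) (L 1) := by
    rw [charFunDual_apply, charFun_apply_real]
    refine integral_congr_ae (Filter.Eventually.of_forall fun x => ?_)
    have : L x = L 1 * x := by
      rw [mul_comm, ← smul_eq_mul, ← map_smul, smul_eq_mul, mul_one]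
    simp only [this, Complex.ofReal_mul]
  rw [h, charFun_gaussianReal]
  congr 1
  push_cast
  ring

theorem Hmulti_eq_prod {e : ℕ → SchwartzR} {α : MultiIndex} {s : Finset ℕ} (h : α.support ⊆ s)
    (ω : TemperedDistR) : Hmulti e α ω = ∏ j ∈ s, hermiteP (α j) (ω (e (j + 1))) :=
  Finsupp.prod_of_support_subset _ h _ fun _ _ => hermiteP_zero _

theorem mfact_eq_prod {α : MultiIndex} {s : Finset ℕ} (h : α.support ⊆ s) :
    mfact α = ∏ j ∈ s, ((α j).factorial : ℝ) :=
  Finsupp.prod_of_support_subset _ h _ fun _ _ => by simp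

theorem mfact_pos (α : MultiIndex) : 0 < mfact α :=
  Finset.prod_pos fun _ _ => by positivity

theorem Hmulti_zero (e : ℕ → SchwartzR) (ω : TemperedDistR) : Hmulti e 0 ω = 1 := by
  simp [Hmulti]

theorem measurable_Hmulti (e : ℕ → SchwartzR) (α : MultiIndex) : Measurable (Hmulti e α) :=
  Finset.measurable_fun_prod _ fun _ _ =>
    (continuous_hermiteP _).measurable.comp (TemperedDistR.measurable_eval _)

theorem eval_mul_Hmulti (e : ℕ → SchwartzR) (k : ℕ) (α : MultiIndex) (ω : TemperedDistR) :
    ω (e (k + 1)) * Hmulti e α ω = Hmulti e (α + Finsupp.single k 1) ω +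
      (α k : ℝ) * Hmulti e (α - Finsupp.single k 1) ω := by
  set s := insert k α.support with hs
  have hk : k ∈ s := Finset.mem_insert_self _ _
  have hα : α.support ⊆ s := Finset.subset_insert _ _
  have h1 : (α + Finsupp.single k 1).support ⊆ s := by
    intro j hj
    by_cases hjk : j = k
    · exact hjk ▸ hk
    · refine hα ?_
      simpa [Finsupp.single_apply, Ne.symm hjk] using hj
  have h2 : (α - Finsupp.single k 1).support ⊆ s := by
    intro j hj
    by_cases hjk : j = k
    · exact hjk ▸ hk
    · refine hα ?_
      simpa [Finsupp.single_apply, Ne.symm hjk] using hj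
  rw [Hmulti_eq_prod hα, Hmulti_eq_prod h1, Hmulti_eq_prod h2, ← Finset.mul_prod_erase s _ hk,
    ← Finset.mul_prod_erase s _ hk, ← Finset.mul_prod_erase s _ hk, ← mul_assoc, mul_hermiteP]
  have e1 : ∏ j ∈ s.erase k, hermiteP ((α + Finsupp.single k 1 : MultiIndex) j) (ω (e (j + 1))) =
      ∏ j ∈ s.erase k, hermiteP (α j) (ω (e (j + 1))) :=
    Finset.prod_congr rfl fun j hj => by
      simp [(Finset.ne_of_mem_erase hj).symm]
  have e2 : ∏ j ∈ s.erase k, hermiteP ((α - Finsupp.single k 1 : MultiIndex) j) (ω (e (j + 1))) =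
      ∏ j ∈ s.erase k, hermiteP (α j) (ω (e (j + 1))) :=
    Finset.prod_congr rfl fun j hj => by
      simp [(Finset.ne_of_mem_erase hj).symm]
  rw [e1, e2]
  simp
  ring

theorem eval_mul_Hmulti_mem_span (e : ℕ → SchwartzR) {ψ : SchwartzR}
    (hψ : ψ ∈ Submodule.span ℝ (Set.range fun j => e (j + 1))) (α : MultiIndex) :
    (fun ω : TemperedDistR => ω ψ) * Hmulti e α ∈ Submodule.span ℝ (Set.range (Hmulti e)) := by
  induction hψ using Submodule.span_induction with
  | mem φ hφ =>
    obtain ⟨k, rfl⟩ := hφ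
    have : (fun ω : TemperedDistR => ω (e (k + 1))) * Hmulti e α =
        Hmulti e (α + Finsupp.single k 1) + (α k : ℝ) • Hmulti e (α - Finsupp.single k 1) :=
      funext (eval_mul_Hmulti e k α)
    rw [this]
    exact Submodule.add_mem _ (Submodule.subset_span ⟨_, rfl⟩)
      (Submodule.smul_mem _ _ (Submodule.subset_span ⟨_, rfl⟩))
  | zero =>
    convert Submodule.zero_mem (Submodule.span ℝ (Set.range (Hmulti e))) using 1
    ext ω; simp
  | add x y _ _ hx hy =>
    convert Submodule.add_mem _ hx hy using 1
    ext ω; simp [add_mul]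
  | smul c x _ hx =>
    convert Submodule.smul_mem _ c hx using 1
    ext ω; simp [mul_assoc]

variable {P : Measure TemperedDistR}

theorem IsWhiteNoise.map_eval [IsProbabilityMeasure P] (hP : IsWhiteNoise P) (φ : SchwartzR) :
    P.map (fun ω => ω φ) = gaussianReal 0 (∫ x, φ x ^ 2).toNNReal := by
  have hm := TemperedDistR.measurable_eval φ
  have := Measure.isProbabilityMeasure_map (μ := P) hm.aemeasurable
  refine Measure.ext_of_charFun (funext fun t => ?_)
  rw [charFun_apply_real, charFun_gaussianReal, integral_map hm.aemeasurable (by fun_prop)]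
  have h := hP (t • φ)
  have h0 : 0 ≤ ∫ x, φ x ^ 2 := integral_nonneg fun x => sq_nonneg _
  calc _ = ∫ ω : TemperedDistR, Complex.exp (Complex.I * ((ω (t • φ) : ℝ) : ℂ)) ∂P := by
        refine integral_congr_ae (Filter.Eventually.of_forall fun ω => ?_)
        simp [mul_comm]
    _ = _ := by
        rw [h]
        congr 1
        simp only [smul_apply, smul_eq_mul, mul_pow, integral_const_mul,
          Real.coe_toNNReal _ h0]
        push_cast
        ring

theorem IsWhiteNoise.integral_eval_sq [IsProbabilityMeasure P] (hP : IsWhiteNoise P)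
    (φ : SchwartzR) : ∫ ω, (ω φ) ^ 2 ∂P = ∫ x, φ x ^ 2 := by
  have hm := TemperedDistR.measurable_eval φ
  have h0 : 0 ≤ ∫ x, φ x ^ 2 := integral_nonneg fun x => sq_nonneg _
  have h1 : ∫ y, y ^ 2 ∂(P.map fun ω => ω φ) = ∫ ω, (ω φ) ^ 2 ∂P :=
    integral_map hm.aemeasurable (by fun_prop)
  have h2 := variance_of_integral_eq_zero (X := id)
    (μ := gaussianReal 0 (∫ x, φ x ^ 2).toNNReal) aemeasurable_id (by simp)
  rw [← h1, hP.map_eval]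
  simpa [Real.coe_toNNReal _ h0] using h2.symm

theorem IsWhiteNoise.memLp_eval [IsProbabilityMeasure P] (hP : IsWhiteNoise P) (φ : SchwartzR) :
    MemLp (fun ω : TemperedDistR => ω φ) 2 P := by
  have hm := TemperedDistR.measurable_eval φ
  have h := memLp_id_gaussianReal' (μ := 0) (v := (∫ x, φ x ^ 2).toNNReal) 2 (by simp)
  rw [← hP.map_eval, memLp_map_measure_iff (by fun_prop) hm.aemeasurable] at h
  exact h

theorem IsWhiteNoise.memLp_exp_abs_eval [IsProbabilityMeasure P] (hP : IsWhiteNoise P)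
    (φ : SchwartzR) : MemLp (fun ω : TemperedDistR => Real.exp |ω φ|) 2 P := by
  have hm := TemperedDistR.measurable_eval φ
  refine (memLp_two_iff_integrable_sq (Real.measurable_exp.comp hm.abs).aestronglyMeasurable).2 ?_
  have h : ∀ t : ℝ, Integrable (fun ω : TemperedDistR => Real.exp (t * ω φ)) P := by
    intro t
    have := integrable_exp_mul_gaussianReal (μ := 0) (v := (∫ x, φ x ^ 2).toNNReal) t
    rw [← hP.map_eval, integrable_map_measure (by fun_prop) hm.aemeasurable] at this
    exact this
  refine (integrable_exp_mul_abs (h 2) (h (-2))).congr (Filter.Eventually.of_forall fun ω => ?_)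
  simp only [Function.comp_apply, ← Real.exp_nat_mul, Nat.cast_ofNat]

/-- Under white noise, evaluations at an orthonormal family are i.i.d. standard Gaussians. -/
theorem IsWhiteNoise.map_eval_pi [IsProbabilityMeasure P] (hP : IsWhiteNoise P) {ι : Type*}
    [Fintype ι] [DecidableEq ι] (v : ι → SchwartzR)
    (hv : ∀ i j, ∫ x, v i x * v j x = if i = j then 1 else 0) :
    P.map (fun ω i => ω (v i)) = Measure.pi fun _ => gaussianReal 0 1 := by
  have hm : Measurable fun (ω : TemperedDistR) i => ω (v i) :=
    measurable_pi_lambda _ fun i => TemperedDistR.measurable_eval _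
  have := Measure.isProbabilityMeasure_map (μ := P) hm.aemeasurable
  refine charFunDual_eq_pi_iff.1 fun L => ?_
  refine (charFunDual_map_eval P TemperedDistR.toLinearMap TemperedDistR.measurable_eval v L).trans
    ((hP _).trans ?_)
  simp only [charFunDual_gaussianReal_zero_one, ← Complex.exp_sum, ← Finset.mul_sum,
    ← Complex.ofReal_sum]
  congr 3
  have h1 : ∀ x, (∑ i, L (Pi.single i 1) • v i) x ^ 2 =
      ∑ i, ∑ j, L (Pi.single i 1) * L (Pi.single j 1) * (v i x * v j x) := by
    intro x
    rw [sum_apply, sq, Finset.sum_mul_sum]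
    refine Finset.sum_congr rfl fun i _ => Finset.sum_congr rfl fun j _ => ?_
    simp only [smul_apply, smul_eq_mul]
    ring
  have hi : ∀ i j, Integrable fun x => L (Pi.single i 1) * L (Pi.single j 1) * (v i x * v j x) :=
    fun i j => (SchwartzMap.integrable_mul_real _ _).const_mul _
  simp only [h1]
  rw [integral_finsetSum _ fun i _ => integrable_finsetSum _ fun j _ => hi i j]
  refine Finset.sum_congr rfl fun i _ => ?_
  rw [integral_finsetSum _ fun j _ => hi i j]
  simp [integral_const_mul, hv, sq]

variable {e : ℕ → SchwartzR}

theorem IsWhiteNoise.integrable_and_integral_Hmulti_mul [IsProbabilityMeasure P]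
    (hP : IsWhiteNoise P) (he : ∀ (k : ℕ) (x : ℝ), e k x = hermiteFun k x) (α β : MultiIndex) :
    Integrable (fun ω => Hmulti e α ω * Hmulti e β ω) P ∧
      ∫ ω, Hmulti e α ω * Hmulti e β ω ∂P = if α = β then mfact α else 0 := by
  set s := α.support ∪ β.support with hs
  have hα : α.support ⊆ s := Finset.subset_union_left
  have hβ : β.support ⊆ s := Finset.subset_union_right
  have hm : Measurable fun (ω : TemperedDistR) (i : s) => ω (e (i + 1)) :=
    measurable_pi_lambda _ fun i => TemperedDistR.measurable_eval _
  have hmap := hP.map_eval_pi (fun i : s => e (i + 1)) fun i j => by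
    simp only [he, integral_hermiteFun_mul, Subtype.ext_iff]
  set F : s → ℝ → ℝ := fun i y => hermiteP (α i) y * hermiteP (β i) y with hF
  have hprod : ∀ ω, Hmulti e α ω * Hmulti e β ω =
      (fun y : s → ℝ => ∏ i, F i (y i)) (fun i => ω (e (i + 1))) := fun ω => by
    rw [Hmulti_eq_prod hα, Hmulti_eq_prod hβ, ← Finset.prod_mul_distrib]
    exact (Finset.prod_coe_sort s fun j =>
      hermiteP (α j) (ω (e (j + 1))) * hermiteP (β j) (ω (e (j + 1)))).symm
  have hFint : Integrable (fun y : s → ℝ => ∏ i, F i (y i))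
      (Measure.pi fun _ => gaussianReal 0 1) :=
    Integrable.fintype_prod fun i => integrable_hermiteP_mul_gaussianReal _ _
  simp only [hprod]
  rw [← hmap] at hFint
  refine ⟨hFint.comp_measurable hm, ?_⟩
  rw [← integral_map hm.aemeasurable hFint.1, hmap, integral_fintype_prod_eq_prod]
  simp only [hF, integral_hermiteP_mul_gaussianReal]
  split_ifs with h
  · subst h
    simp only [if_true]
    rw [mfact_eq_prod hα]
    exact Finset.prod_coe_sort s fun j => ((α j).factorial : ℝ)
  · obtain ⟨j, hj⟩ := Finsupp.ne_iff.1 h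
    have hjs : j ∈ s := by
      by_contra hjs
      exact hj (by rw [Finsupp.notMem_support_iff.1 fun h => hjs (hα h),
        Finsupp.notMem_support_iff.1 fun h => hjs (hβ h)])
    exact Finset.prod_eq_zero (Finset.mem_univ ⟨j, hjs⟩) (if_neg hj)

theorem IsWhiteNoise.memLp_Hmulti [IsProbabilityMeasure P] (hP : IsWhiteNoise P)
    (he : ∀ (k : ℕ) (x : ℝ), e k x = hermiteFun k x) (α : MultiIndex) :
    MemLp (Hmulti e α) 2 P := by
  rw [memLp_two_iff_integrable_sq (measurable_Hmulti e α).aestronglyMeasurable]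
  simpa only [sq] using (hP.integrable_and_integral_Hmulti_mul he α α).1

/-- A square-integrable variable orthogonal to all the `H_α` vanishes. -/
theorem IsWhiteNoise.ae_eq_zero_of_integral_mul_Hmulti [IsProbabilityMeasure P]
    (hP : IsWhiteNoise P) (he : ∀ (k : ℕ) (x : ℝ), e k x = hermiteFun k x)
    {X : TemperedDistR → ℝ} (hX : MemLp X 2 P) (h : ∀ α, ∫ ω, X ω * Hmulti e α ω ∂P = 0) :
    X =ᵐ[P] 0 := by
  have hXi : Integrable X P := hX.integrable one_le_two
  have hspan : ∀ ψ ∈ Submodule.span ℝ (Set.range fun j => e (j + 1)),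
      ∫ ω, (X ω : ℂ) * Complex.exp (Complex.I * (ω ψ : ℂ)) ∂P = 0 := by
    intro ψ hψ
    refine integral_mul_cexp_eq_zero_of_integral_mul_pow_eq_zero hX.1
      (TemperedDistR.measurable_eval ψ).aestronglyMeasurable
      (hX.integrable_mul (hP.memLp_exp_abs_eval ψ)) fun n => ?_
    refine (integrable_and_integral_mul_eq_zero_of_mem_span (S := Set.range (Hmulti e)) ?_
      (pow_mem_span_of_mul_mem_span (Z := fun ω : TemperedDistR => ω ψ)
        (Submodule.subset_span (Set.mem_range.2 ⟨0, funext (Hmulti_zero e)⟩)) ?_ n)).2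
    · rintro _ ⟨α, rfl⟩
      exact ⟨hX.integrable_mul (hP.memLp_Hmulti he α), h α⟩
    · rintro _ ⟨α, rfl⟩
      exact eval_mul_Hmulti_mem_span e hψ α
  refine ae_eq_zero_of_integral_mul_cexp_eval (Y := TemperedDistR.toLinearMap)
    TemperedDistR.measurableSpace_eq_comap hXi fun φ => ?_
  change ∫ ω, (X ω : ℂ) * Complex.exp (Complex.I * ((ω φ : ℝ) : ℂ)) ∂P = 0
  have hint : ∀ ψ : SchwartzR, Integrable
      (fun ω => (X ω : ℂ) * Complex.exp (Complex.I * ((ω ψ : ℝ) : ℂ))) P := fun ψ => by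
    have hm : AEStronglyMeasurable
        (fun ω : TemperedDistR => Complex.exp (Complex.I * ((ω ψ : ℝ) : ℂ))) P :=
      (Complex.continuous_exp.measurable.comp (measurable_const.mul
        (Complex.measurable_ofReal.comp (TemperedDistR.measurable_eval ψ)))).aestronglyMeasurable
    refine hXi.ofReal.mul_bdd (c := 1) hm (Filter.Eventually.of_forall fun ω => ?_)
    rw [Complex.norm_exp_I_mul_ofReal]
  have hbound : ∀ ψ ∈ Submodule.span ℝ (Set.range fun j => e (j + 1)),
      ‖∫ ω, (X ω : ℂ) * Complex.exp (Complex.I * ((ω φ : ℝ) : ℂ)) ∂P‖ ≤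
        Real.sqrt (∫ ω, X ω ^ 2 ∂P) * Real.sqrt (∫ x, (φ - ψ) x ^ 2) := by
    intro ψ hψ
    have hholder := integral_mul_le_Lp_mul_Lq_of_nonneg (μ := P) Real.HolderConjugate.two_two
      (f := fun ω => |X ω|) (g := fun ω : TemperedDistR => |ω (φ - ψ)|)
      (Filter.Eventually.of_forall fun _ => abs_nonneg _)
      (Filter.Eventually.of_forall fun _ => abs_nonneg _) (by rw [ENNReal.ofReal_ofNat]; exact hX.abs)
      (by rw [ENNReal.ofReal_ofNat]; exact (hP.memLp_eval (φ - ψ)).abs)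
    simp only [Real.rpow_two, sq_abs, hP.integral_eval_sq, ← Real.sqrt_eq_rpow] at hholder
    refine le_trans ?_ hholder
    rw [← sub_zero (∫ ω, (X ω : ℂ) * Complex.exp (Complex.I * ((ω φ : ℝ) : ℂ)) ∂P),
      ← hspan ψ hψ, ← integral_sub (hint φ) (hint ψ)]
    refine norm_integral_le_of_norm_le (hX.abs.integrable_mul (hP.memLp_eval (φ - ψ)).abs)
      (Filter.Eventually.of_forall fun ω => ?_)
    have hfac : Complex.exp (Complex.I * ((ω φ : ℝ) : ℂ)) =
        Complex.exp (Complex.I * ((ω ψ : ℝ) : ℂ)) *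
          Complex.exp (Complex.I * ((ω (φ - ψ) : ℝ) : ℂ)) := by
      rw [← Complex.exp_add, map_sub]; push_cast; ring_nf
    rw [← mul_sub, hfac, ← mul_sub_one, norm_mul, norm_mul, Complex.norm_exp_I_mul_ofReal, one_mul,
      Complex.norm_real, Real.norm_eq_abs]
    exact mul_le_mul_of_nonneg_left Real.norm_exp_I_mul_ofReal_sub_one_le (abs_nonneg _)
  obtain ⟨u, hu, hlim⟩ := exists_seq_span_hermite_tendsto e he φ
  have hlim' := (hlim.sqrt).const_mul (Real.sqrt (∫ ω, X ω ^ 2 ∂P))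
  rw [Real.sqrt_zero, mul_zero] at hlim'
  exact norm_le_zero_iff.1 (ge_of_tendsto' hlim' fun n => hbound _ (hu n))

end WhiteNoise
/-- **Wiener–Itô chaos expansion theorem.** If `P` is a white noise probability measure on
`𝒮'(ℝ)`, then the family `{(α!)^{−1/2} H_α}_{α ∈ 𝒥}` is an orthonormal Hilbert basis of
`L²(P)`: it is orthonormal and its closed linear span is everything. Consequently every
`X ∈ L²(P)` has a unique expansion `X = Σ_α c_α H_α` (convergent in `L²(P)`) with real
coefficients, and `‖X‖² = Σ_α α! c_α²`. -/
theorem wiener_ito_chaos_expansion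
    (P : Measure TemperedDistR) [IsProbabilityMeasure P]
    (hP : ∀ φ : SchwartzR,
      ∫ ω, Complex.exp (Complex.I * ((ω φ : ℝ) : ℂ)) ∂P
        = Complex.exp (-(1/2) * ((∫ x, (φ x)^2 : ℝ) : ℂ)))
    (e : ℕ → SchwartzR) (he : ∀ (k : ℕ) (x : ℝ), e k x = hermiteFun k x) :
    ∃ H : MultiIndex → Lp ℝ 2 P,
      (∀ α : MultiIndex, ∀ᵐ ω ∂P, H α ω = Hmulti e α ω) ∧
      Orthonormal ℝ (fun α : MultiIndex => (Real.sqrt (mfact α))⁻¹ • H α) ∧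
      (Submodule.span ℝ (Set.range H)).topologicalClosure = ⊤ ∧
      (∀ X : Lp ℝ 2 P, ∃! c : MultiIndex → ℝ,
        HasSum (fun α : MultiIndex => c α • H α) X ∧
        ‖X‖^2 = ∑' α : MultiIndex, mfact α * (c α)^2) := by
  have hW : IsWhiteNoise P := hP
  set H : MultiIndex → Lp ℝ 2 P := fun α => (hW.memLp_Hmulti he α).toLp with hH
  have hcoe : ∀ α, ∀ᵐ ω ∂P, H α ω = Hmulti e α ω := fun α => MemLp.coeFn_toLp _
  have hinner : ∀ α β, inner ℝ (H α) (H β) = if α = β then mfact α else 0 := fun α β => by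
    rw [← (hW.integrable_and_integral_Hmulti_mul he α β).2, L2.inner_def]
    refine integral_congr_ae ?_
    filter_upwards [hcoe α, hcoe β] with ω h1 h2
    simp [h1, h2, mul_comm]
  have hsq : ∀ α, Real.sqrt (mfact α) * Real.sqrt (mfact α) = mfact α := fun α =>
    Real.mul_self_sqrt (mfact_pos α).le
  have hsq0 : ∀ α, Real.sqrt (mfact α) ≠ 0 := fun α => (Real.sqrt_pos.2 (mfact_pos α)).ne'
  have hon : Orthonormal ℝ (fun α : MultiIndex => (Real.sqrt (mfact α))⁻¹ • H α) := by
    rw [orthonormal_iff_ite]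
    intro α β
    rw [real_inner_smul_left, real_inner_smul_right, hinner]
    split_ifs with h
    · subst h
      nth_rewrite 3 [← hsq α]
      field_simp [hsq0 α]
    · simp
  have horth : ∀ X : Lp ℝ 2 P, (∀ α, inner ℝ (H α) X = 0) → X = 0 := fun X hX => by
    refine Lp.ext ((hW.ae_eq_zero_of_integral_mul_Hmulti he (Lp.memLp X) fun α => ?_).trans
      (Lp.coeFn_zero _ _ _).symm)
    rw [← hX α, L2.inner_def]
    refine integral_congr_ae ?_
    filter_upwards [hcoe α] with ω h1
    simp [h1]
  have hbot : (Submodule.span ℝ (Set.range fun α => (Real.sqrt (mfact α))⁻¹ • H α))ᗮ = ⊥ := by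
    refine (Submodule.eq_bot_iff _).2 fun X hX => horth X fun α => ?_
    have h := hX _ (Submodule.subset_span ⟨α, rfl⟩)
    rw [real_inner_smul_left] at h
    exact (mul_eq_zero.1 h).resolve_left (inv_ne_zero (hsq0 α))
  refine ⟨H, hcoe, hon, ?_, fun X => ?_⟩
  · rw [Submodule.topologicalClosure_eq_top_iff, Submodule.eq_bot_iff]
    exact fun X hX => horth X fun α => hX _ (Submodule.subset_span ⟨α, rfl⟩)
  set b := HilbertBasis.mkOfOrthogonalEqBot hon hbot with hb
  have hbα : ∀ α, b α = (Real.sqrt (mfact α))⁻¹ • H α := fun α => by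
    rw [hb, HilbertBasis.coe_mkOfOrthogonalEqBot]
  have hrepr : ∀ α, b.repr X α = inner ℝ (b α) X := fun α => b.repr_apply_apply X α
  refine ⟨fun α => (Real.sqrt (mfact α))⁻¹ * b.repr X α, ⟨?_, ?_⟩, ?_⟩
  · refine (b.hasSum_repr X).congr_fun fun α => ?_
    rw [hbα, smul_smul, mul_comm]
  · have h := (b.tsum_inner_mul_inner X X)
    rw [real_inner_self_eq_norm_sq] at h
    rw [← h]
    refine tsum_congr fun α => ?_
    beta_reduce
    rw [hrepr, real_inner_comm, mul_pow, inv_pow, Real.sq_sqrt (mfact_pos α).le,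
      mul_inv_cancel_left₀ (mfact_pos α).ne', sq]
  · rintro c ⟨hc, -⟩
    ext α
    have h1 := hc.mapL (innerSL ℝ (H α))
    have h2 := hasSum_ite_eq α (c α * mfact α)
    have h3 : inner ℝ (H α) X = c α * mfact α := by
      refine h1.unique (h2.congr_fun fun β => ?_)
      simp only [innerSL_apply_apply, real_inner_smul_right, hinner]
      by_cases h : β = α
      · subst h; simp
      · simp [h, Ne.symm h]
    rw [hrepr, hbα, real_inner_smul_left, h3]
    nth_rewrite 3 [← hsq α]
    field_simp [hsq0 α]

end
end

section
/- For a real number q, the series Σ_{α ∈ 𝒥} (2ℕ)^{−qα} converges (i.e. the family ((2ℕ)^{−qα})_{α ∈ 𝒥} is summable) if and only if q > 1. -/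
open MeasureTheory

noncomputable section

/-- `(2ℕ)^{qα} = Π_j (2j)^{q α_j}` for a real exponent `q` and a multi-index `α`
(index `j : ℕ` of the finsupp stands for the integer `j + 1`). -/
def twoNpow (q : ℝ) (α : MultiIndex) : ℝ :=
  α.prod fun j n => ((2 * (j + 1) : ℕ) : ℝ) ^ (q * (n : ℝ))

/-- The multivariate geometric series `∑ α, x ^ α` over all multi-indices converges if `x` is a
summable family in `[0, r]` for some `r < 1`. -/
theorem summable_finsupp_prod_pow {ι : Type*} {x : ι → ℝ} {r : ℝ} (hr : r < 1)
    (hx0 : ∀ j, 0 ≤ x j) (hxr : ∀ j, x j ≤ r) (hx : Summable x) :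
    Summable fun α : ι →₀ ℕ => α.prod fun j n => x j ^ n := by
  classical
  have hr' : 0 < 1 - r := sub_pos.2 hr
  have hgeom (j : ι) (t : Finset ℕ) : ∑ n ∈ t, x j ^ n ≤ Real.exp (x j / (1 - r)) := by
    have hj : x j < 1 := (hxr j).trans_lt hr
    have hj' : 0 < 1 - x j := sub_pos.2 hj
    calc ∑ n ∈ t, x j ^ n ≤ ∑' n, x j ^ n :=
          (summable_geometric_of_lt_one (hx0 j) hj).sum_le_tsum t
            fun n _ => pow_nonneg (hx0 j) n
      _ = x j / (1 - x j) + 1 := by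
          rw [tsum_geometric_of_lt_one (hx0 j) hj]
          field_simp
          ring
      _ ≤ x j / (1 - r) + 1 := by
          have := hx0 j
          have := hxr j
          gcongr
      _ ≤ Real.exp (x j / (1 - r)) := Real.add_one_le_exp _
  refine summable_of_sum_le (c := Real.exp (∑' j, x j / (1 - r)))
    (fun α => Finset.prod_nonneg fun j _ => pow_nonneg (hx0 j) _) fun T => ?_
  set s : Finset ι := T.sup Finsupp.support
  set t : ι → Finset ℕ := fun j => T.image fun α => α j
  have hs {α : ι →₀ ℕ} (hα : α ∈ T) : α.support ⊆ s := Finset.le_sup (f := Finsupp.support) hα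
  have hT : T ⊆ s.finsupp t := fun α hα =>
    Finset.mem_finsupp_iff.2 ⟨hs hα, fun j _ => Finset.mem_image_of_mem _ hα⟩
  calc ∑ α ∈ T, α.prod (fun j n => x j ^ n)
      ≤ ∑ α ∈ s.finsupp t, α.prod (fun j n => x j ^ n) :=
        Finset.sum_le_sum_of_subset_of_nonneg hT fun α _ _ =>
          Finset.prod_nonneg fun j _ => pow_nonneg (hx0 j) _
    _ = ∑ α ∈ s.finsupp t, ∏ j ∈ s, x j ^ α j :=
        Finset.sum_congr rfl fun α hα =>
          Finsupp.prod_of_support_subset α (Finset.mem_finsupp_iff.1 hα).1 _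
            fun j _ => pow_zero _
    _ = ∏ j ∈ s, ∑ n ∈ t j, x j ^ n := by
        rw [Finset.prod_sum, Finset.finsupp, Finset.sum_map]
        refine Finset.sum_congr rfl fun p _ => ?_
        rw [← Finset.prod_attach]
        refine Finset.prod_congr rfl fun j _ => ?_
        simp [Finsupp.indicator_of_mem j.2]
    _ ≤ ∏ j ∈ s, Real.exp (x j / (1 - r)) :=
        Finset.prod_le_prod (fun j _ => Finset.sum_nonneg fun n _ => pow_nonneg (hx0 j) n)
          fun j _ => hgeom j _
    _ = Real.exp (∑ j ∈ s, x j / (1 - r)) := (Real.exp_sum _ _).symm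
    _ ≤ Real.exp (∑' j, x j / (1 - r)) :=
        Real.exp_le_exp.2 <| (hx.div_const _).sum_le_tsum s
          fun j _ => div_nonneg (hx0 j) hr'.le

theorem twoNpow_eq_prod_pow (q : ℝ) (α : MultiIndex) :
    twoNpow q α = α.prod fun j n => (((2 * (j + 1) : ℕ) : ℝ) ^ q) ^ n :=
  Finsupp.prod_congr fun _ _ => Real.rpow_mul_natCast (Nat.cast_nonneg _) _ _

theorem summable_two_mul_succ_rpow_iff (q : ℝ) :
    Summable (fun j : ℕ => ((2 * (j + 1) : ℕ) : ℝ) ^ (-q)) ↔ 1 < q := by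
  have h (j : ℕ) : ((2 * (j + 1) : ℕ) : ℝ) ^ (-q) = 2 ^ (-q) * ((j + 1 : ℕ) : ℝ) ^ (-q) := by
    rw [Nat.cast_mul, Real.mul_rpow (by positivity) (by positivity), Nat.cast_ofNat]
  simp_rw [h]
  rw [summable_mul_left_iff (by positivity),
    summable_nat_add_iff (f := fun j : ℕ => (j : ℝ) ^ (-q)) 1, Real.summable_nat_rpow, neg_lt_neg_iff]

/-- The series `Σ_{α ∈ 𝒥} (2ℕ)^{−qα}` converges if and only if `q > 1`. -/
theorem twoNpow_summable_iff (q : ℝ) :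
    Summable (fun α : MultiIndex => twoNpow (-q) α) ↔ 1 < q := by
  simp_rw [twoNpow_eq_prod_pow]
  refine ⟨fun h => ?_, fun hq => ?_⟩
  · rw [← summable_two_mul_succ_rpow_iff]
    refine (h.comp_injective (Finsupp.single_left_injective one_ne_zero)).congr fun j => ?_
    simp [Finsupp.prod_single_index]
  · refine summable_finsupp_prod_pow (r := 2 ^ (-q))
      (Real.rpow_lt_one_of_one_lt_of_neg one_lt_two (by linarith)) (fun j => by positivity)
      (fun j => ?_) ((summable_two_mul_succ_rpow_iff q).2 hq)
    refine Real.rpow_le_rpow_of_nonpos two_pos ?_ (by linarith)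
    exact_mod_cast (by lia : 2 ≤ 2 * (j + 1))

end
end

section
/- (Zhang's characterization of the Hida distribution space, coefficient form.) Let c : 𝒥 → ℝ be a family of real coefficients. Then the following are equivalent: (i) there exists q ∈ ℕ such that Σ_{α ∈ 𝒥} α!·c_α²·(2ℕ)^{−qα} < ∞; (ii) there exists q ∈ ℕ such that sup_{α ∈ 𝒥} α!·c_α²·(2ℕ)^{−qα} < ∞. -/
open MeasureTheory

noncomputable section

/-- Finite sums of monomials in nonnegative variables are bounded by finite products of
geometric series. -/
lemma sum_finsupp_prod_pow_le (x : ℕ → ℝ) (hx0 : ∀ j, 0 ≤ x j) (hx1 : ∀ j, x j < 1)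
    (s : Finset MultiIndex) :
    ∃ N : ℕ, ∑ α ∈ s, (α.prod fun j n => x j ^ n) ≤ ∏ j ∈ Finset.range N, (1 - x j)⁻¹ := by
  classical
  obtain ⟨N, hN⟩ := Finset.exists_nat_subset_range (s.biUnion fun α => α.support)
  obtain ⟨K, hK⟩ := Finset.exists_nat_subset_range
    (s.biUnion fun α => (Finset.range N).image fun j => α j)
  have hsupp : ∀ α ∈ s, α.support ⊆ Finset.range N := fun α hα =>
    (Finset.subset_biUnion_of_mem (fun α : MultiIndex => α.support) hα).trans hN
  have hval : ∀ α ∈ s, ∀ j < N, α j < K := fun α hα j hj => by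
    refine Finset.mem_range.1 (hK (Finset.mem_biUnion.2 ⟨α, hα, ?_⟩))
    exact Finset.mem_image.2 ⟨j, Finset.mem_range.2 hj, rfl⟩
  have hinj : Set.InjOn (fun (α : MultiIndex) (i : Fin N) => α i) s := by
    intro α hα β hβ h
    ext j
    by_cases hj : j < N
    · exact congrFun h ⟨j, hj⟩
    · have hout : ∀ γ ∈ s, γ j = 0 := fun γ hγ => by
        by_contra h0
        exact hj (Finset.mem_range.1 (hsupp γ hγ (Finsupp.mem_support_iff.2 h0)))
      rw [hout α hα, hout β hβ]
  refine ⟨N, ?_⟩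
  calc ∑ α ∈ s, (α.prod fun j n => x j ^ n)
      = ∑ α ∈ s, ∏ i : Fin N, x i ^ α i := by
        refine Finset.sum_congr rfl fun α hα => ?_
        rw [Finsupp.prod_of_support_subset α (hsupp α hα) _ (fun j _ => pow_zero _),
          Finset.prod_range]
    _ = ∑ p ∈ s.image (fun (α : MultiIndex) (i : Fin N) => α i), ∏ i : Fin N, x i ^ p i := by
        rw [Finset.sum_image hinj]
    _ ≤ ∑ p ∈ Fintype.piFinset (fun _ : Fin N => Finset.range K), ∏ i : Fin N, x i ^ p i := by
        refine Finset.sum_le_sum_of_subset_of_nonneg ?_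
          (fun p _ _ => Finset.prod_nonneg fun i _ => pow_nonneg (hx0 i) _)
        intro p hp
        obtain ⟨α, hα, rfl⟩ := Finset.mem_image.1 hp
        exact Fintype.mem_piFinset.2 fun i => Finset.mem_range.2 (hval α hα i i.2)
    _ = ∏ i : Fin N, ∑ n ∈ Finset.range K, x i ^ n :=
        (Finset.prod_univ_sum (fun _ : Fin N => Finset.range K) fun i n => x i ^ n).symm
    _ ≤ ∏ i : Fin N, (1 - x i)⁻¹ := by
        refine Finset.prod_le_prod
          (fun i _ => Finset.sum_nonneg fun n _ => pow_nonneg (hx0 i) n) fun i _ => ?_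
        rw [← tsum_geometric_of_lt_one (hx0 i) (hx1 i)]
        exact (summable_geometric_of_lt_one (hx0 i) (hx1 i)).sum_le_tsum _
          fun n _ => pow_nonneg (hx0 i) n
    _ = ∏ j ∈ Finset.range N, (1 - x j)⁻¹ := (Finset.prod_range fun j => (1 - x j)⁻¹).symm

lemma twoNpow_nonneg (q : ℝ) (α : MultiIndex) : 0 ≤ twoNpow q α :=
  Finset.prod_nonneg fun _ _ => Real.rpow_nonneg (Nat.cast_nonneg _) _

lemma mfact_nonneg (α : MultiIndex) : 0 ≤ mfact α :=
  Finset.prod_nonneg fun _ _ => Nat.cast_nonneg _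

lemma twoNpow_add (p q : ℝ) (α : MultiIndex) :
    twoNpow (p + q) α = twoNpow p α * twoNpow q α := by
  unfold twoNpow
  rw [← Finsupp.prod_mul]
  refine Finsupp.prod_congr fun j _ => ?_
  rw [add_mul, Real.rpow_add (by positivity)]

lemma twoNpow_neg_two (α : MultiIndex) :
    twoNpow (-2) α = α.prod fun j n => ((2 * ((j : ℝ) + 1)) ^ 2)⁻¹ ^ n := by
  refine Finsupp.prod_congr fun j _ => ?_
  rw [Real.rpow_mul (by positivity), Real.rpow_natCast, Real.rpow_neg (by positivity)]
  norm_num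

lemma inv_two_mul_sq_lt_one (j : ℕ) : ((2 * ((j : ℝ) + 1)) ^ 2)⁻¹ < 1 := by
  have hj : (0 : ℝ) ≤ j := Nat.cast_nonneg j
  exact inv_lt_one_of_one_lt₀ (by nlinarith)

/-- An elementary bound for the partial products of the Wallis product. -/
lemma prod_inv_one_sub_le (N : ℕ) :
    ∏ j ∈ Finset.range N, (1 - ((2 * ((j : ℝ) + 1)) ^ 2)⁻¹)⁻¹ ≤ (2 * (N : ℝ) + 1) / (N + 1) := by
  induction N with
  | zero => simp
  | succ N ih =>
    rw [Finset.prod_range_succ]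
    have hN : (0 : ℝ) ≤ N := Nat.cast_nonneg N
    have hfac : (1 - ((2 * ((N : ℝ) + 1)) ^ 2)⁻¹)⁻¹
        = (2 * ((N : ℝ) + 1)) ^ 2 / ((2 * N + 1) * (2 * N + 3)) := by
      have h : 1 - ((2 * ((N : ℝ) + 1)) ^ 2)⁻¹
          = ((2 * N + 1) * (2 * N + 3)) / (2 * ((N : ℝ) + 1)) ^ 2 := by
        field_simp
        ring
      rw [h, inv_div]
    refine (mul_le_mul_of_nonneg_right ih
      (inv_nonneg.2 (sub_nonneg.2 (inv_two_mul_sq_lt_one N).le))).trans ?_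
    have hprod : (2 * (N : ℝ) + 1) / (N + 1) *
        ((2 * ((N : ℝ) + 1)) ^ 2 / ((2 * N + 1) * (2 * N + 3)))
        = 4 * (N + 1) / (2 * N + 3) := by
      field_simp
      ring
    rw [hfac, hprod]
    push_cast
    rw [div_le_div_iff₀ (by positivity) (by positivity)]
    nlinarith

lemma summable_twoNpow_neg_two : Summable (twoNpow (-2)) := by
  refine summable_of_sum_le (c := 2) (twoNpow_nonneg _) fun s => ?_
  simp only [twoNpow_neg_two]
  obtain ⟨N, hN⟩ := sum_finsupp_prod_pow_le (fun j => ((2 * ((j : ℝ) + 1)) ^ 2)⁻¹)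
    (fun j => by positivity) inv_two_mul_sq_lt_one s
  refine hN.trans ((prod_inv_one_sub_le N).trans ?_)
  rw [div_le_iff₀ (by positivity)]
  linarith

/-- **Zhang's characterization of the Hida distribution space** (coefficient form):
there exists `q ∈ ℕ` with `Σ_α α! c_α² (2ℕ)^{−qα} < ∞` if and only if there exists
`q ∈ ℕ` with `sup_α α! c_α² (2ℕ)^{−qα} < ∞`. -/
theorem zhang_distribution_characterization (c : MultiIndex → ℝ) :
    (∃ q : ℕ, Summable (fun α : MultiIndex => mfact α * (c α)^2 * twoNpow (-(q : ℝ)) α)) ↔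
    (∃ q : ℕ, ∃ M : ℝ, ∀ α : MultiIndex, mfact α * (c α)^2 * twoNpow (-(q : ℝ)) α ≤ M) := by
  have hnonneg : ∀ (q : ℝ) (α : MultiIndex), 0 ≤ mfact α * (c α)^2 * twoNpow q α :=
    fun q α => mul_nonneg (mul_nonneg (mfact_nonneg α) (sq_nonneg _)) (twoNpow_nonneg q α)
  constructor
  · rintro ⟨q, hq⟩
    exact ⟨q, _, fun α => hq.le_tsum α fun β _ => hnonneg _ β⟩
  · rintro ⟨q, M, hM⟩
    refine ⟨q + 2, Summable.of_nonneg_of_le (fun α => hnonneg _ α) (fun α => ?_)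
      (summable_twoNpow_neg_two.mul_left M)⟩
    have hq : -((q + 2 : ℕ) : ℝ) = -(q : ℝ) + -2 := by
      push_cast
      ring
    rw [hq, twoNpow_add, ← mul_assoc]
    exact mul_le_mul_of_nonneg_right (hM α) (twoNpow_nonneg _ α)

end
end

section
/- Let ν be a σ-finite Borel measure on ℝ with ∫_ℝ ζ² dν(ζ) < ∞, and define Ψ : ℝ → ℂ by Ψ(w) = ∫_ℝ (e^{iwζ} − 1 − iwζ) dν(ζ) (well-defined since |e^{iwζ} − 1 − iwζ| ≤ w²ζ²/2). Then the functional h : 𝒮(ℝ) → ℂ given by h(φ) := exp(∫_ℝ Ψ(φ(x)) dx) satisfies: (i) h(0) = 1; (ii) h is continuous with respect to the Fréchet topology of 𝒮(ℝ); (iii) h is positive definite, i.e. for every n ∈ ℕ, all z₁,…,zₙ ∈ ℂ and all φ₁,…,φₙ ∈ 𝒮(ℝ), the sum Σ_{j,ℓ=1}^n z_j·conj(z_ℓ)·h(φ_j − φ_ℓ) is a nonnegative real number. -/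
open MeasureTheory
open scoped ComplexOrder

noncomputable section

/-- `Ψ(w) = ∫ (e^{iwζ} − 1 − iwζ) dν(ζ)` for a Lévy measure `ν`. -/
def levyPsi (ν : Measure ℝ) (w : ℝ) : ℂ :=
  ∫ ζ, (Complex.exp (Complex.I * (w : ℂ) * (ζ : ℂ)) - 1 - Complex.I * (w : ℂ) * (ζ : ℂ)) ∂ν

/-- The Lévy characteristic functional `h(φ) = exp(∫ Ψ(φ(x)) dx)` on the Schwartz space. -/
def levyFunctional (ν : Measure ℝ) (φ : SchwartzR) : ℂ :=
  Complex.exp (∫ x, levyPsi ν (φ x))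

/-- The compensated character `t ↦ e^{it} − 1 − it` is Lipschitz with constant `|a| + |b|` between
`a` and `b`. -/
lemma norm_cexp_compensated_sub_le (a b : ℝ) :
    ‖(Complex.exp (Complex.I * a) - 1 - Complex.I * a) -
      (Complex.exp (Complex.I * b) - 1 - Complex.I * b)‖ ≤ |a - b| * (|a| + |b|) := by
  have hderiv (t : ℝ) : HasDerivAt (fun t : ℝ ↦ Complex.exp (Complex.I * t) - 1 - Complex.I * t)
      (Complex.I * (Complex.exp (Complex.I * t) - 1)) t := by
    have h : HasDerivAt (fun t : ℝ ↦ Complex.I * (t : ℂ)) Complex.I t := by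
      simpa using (Complex.ofRealCLM.hasDerivAt (x := t)).const_mul Complex.I
    exact ((h.cexp.sub_const 1).sub h).congr_deriv (by ring)
  have hbound (t : ℝ) (ht : t ∈ Set.uIcc b a) :
      ‖Complex.I * (Complex.exp (Complex.I * t) - 1)‖ ≤ |a| + |b| := by
    rw [norm_mul, Complex.norm_I, one_mul]
    refine Real.norm_exp_I_mul_ofReal_sub_one_le.trans ?_
    rw [Real.norm_eq_abs]
    rcases Set.mem_uIcc.1 ht with h | h <;>
      exact (abs_le_max_abs_abs h.1 h.2).trans
        (max_le (by linarith [abs_nonneg a, abs_nonneg b])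
          (by linarith [abs_nonneg a, abs_nonneg b]))
  rw [mul_comm |a - b|]
  exact (convex_uIcc b a).norm_image_sub_le_of_norm_hasDerivWithin_le
    (fun t _ ↦ (hderiv t).hasDerivWithinAt) hbound Set.left_mem_uIcc Set.right_mem_uIcc

lemma integral_sub_sub {α : Type*} [MeasurableSpace α] {μ : Measure α} {f g k : α → ℂ}
    (hf : Integrable f μ) (hg : Integrable g μ) (hk : Integrable k μ) :
    ∫ x, (f x - g x - k x) ∂μ = ∫ x, f x ∂μ - ∫ x, g x ∂μ - ∫ x, k x ∂μ := by
  have hfg : Integrable (fun x ↦ f x - g x) μ := hf.sub hg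
  rw [integral_sub hfg hk, integral_sub hf hg]

section LevyPsi

variable {ν : Measure ℝ}

lemma norm_levyPsi_integrand_sub_le (a b ζ : ℝ) :
    ‖(Complex.exp (Complex.I * (a : ℂ) * (ζ : ℂ)) - 1 - Complex.I * (a : ℂ) * (ζ : ℂ)) -
      (Complex.exp (Complex.I * (b : ℂ) * (ζ : ℂ)) - 1 - Complex.I * (b : ℂ) * (ζ : ℂ))‖ ≤
      |a - b| * (|a| + |b|) * ζ ^ 2 := by
  have h := norm_cexp_compensated_sub_le (a * ζ) (b * ζ)
  rw [← sub_mul, abs_mul, abs_mul, abs_mul, ← add_mul] at h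
  push_cast at h
  simp only [mul_assoc]
  simp only [mul_assoc] at h
  refine h.trans_eq ?_
  rw [← sq_abs]
  ring

lemma integrable_levyPsi_integrand (hν : Integrable (fun ζ : ℝ => ζ ^ 2) ν) (w : ℝ) :
    Integrable (fun ζ : ℝ ↦
      Complex.exp (Complex.I * (w : ℂ) * (ζ : ℂ)) - 1 - Complex.I * (w : ℂ) * (ζ : ℂ)) ν := by
  refine (hν.const_mul (|w - 0| * (|w| + |0|))).mono'
    (Continuous.aestronglyMeasurable (by fun_prop)) (.of_forall fun ζ ↦ ?_)
  simpa using norm_levyPsi_integrand_sub_le w 0 ζ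

@[simp]
lemma levyPsi_zero : levyPsi ν 0 = 0 := by simp [levyPsi]

lemma norm_levyPsi_sub_le (hν : Integrable (fun ζ : ℝ => ζ ^ 2) ν) (a b : ℝ) :
    ‖levyPsi ν a - levyPsi ν b‖ ≤ |a - b| * (|a| + |b|) * ∫ ζ, ζ ^ 2 ∂ν := by
  rw [levyPsi, levyPsi, ← integral_sub (integrable_levyPsi_integrand hν a)
    (integrable_levyPsi_integrand hν b), ← integral_const_mul]
  exact norm_integral_le_of_norm_le (hν.const_mul _)
    (.of_forall fun ζ ↦ norm_levyPsi_integrand_sub_le a b ζ)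

lemma continuous_levyPsi (hν : Integrable (fun ζ : ℝ => ζ ^ 2) ν) : Continuous (levyPsi ν) := by
  refine continuous_iff_continuousAt.2 fun b ↦ tendsto_iff_norm_sub_tendsto_zero.2 ?_
  have h : Filter.Tendsto (fun a : ℝ ↦ |a - b| * (|a| + |b|) * ∫ ζ, ζ ^ 2 ∂ν) (nhds b) (nhds 0) :=
    Continuous.tendsto' (by fun_prop) _ _ (by simp)
  exact squeeze_zero (fun _ ↦ norm_nonneg _) (fun a ↦ norm_levyPsi_sub_le hν a b) h

lemma star_levyPsi (w : ℝ) : star (levyPsi ν w) = levyPsi ν (-w) := by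
  simp only [levyPsi, ← starRingEnd_apply]
  rw [← integral_conj]
  simp [← Complex.exp_conj]

lemma integrable_levyPsi_comp (hν : Integrable (fun ζ : ℝ => ζ ^ 2) ν) (φ : SchwartzR) :
    Integrable (fun x ↦ levyPsi ν (φ x)) := by
  have hφ : Integrable (fun x ↦ φ x ^ 2) := (φ.memLp 2).integrable_sq
  refine ((hφ.const_mul 2).mul_const (∫ ζ, ζ ^ 2 ∂ν)).mono'
    ((continuous_levyPsi hν).comp φ.continuous).aestronglyMeasurable (.of_forall fun x ↦ ?_)
  have hM : 0 ≤ ∫ ζ, ζ ^ 2 ∂ν := integral_nonneg fun ζ ↦ sq_nonneg ζ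
  refine (by simpa [← sq] using norm_levyPsi_sub_le hν (φ x) 0 :
    ‖levyPsi ν (φ x)‖ ≤ φ x ^ 2 * ∫ ζ, ζ ^ 2 ∂ν).trans ?_
  gcongr
  linarith [sq_nonneg (φ x)]

lemma star_integral_levyPsi_comp (φ : SchwartzR) :
    star (∫ x, levyPsi ν (φ x)) = ∫ x, levyPsi ν (-φ x) := by
  simp only [← star_levyPsi, ← starRingEnd_apply]
  exact integral_conj.symm

lemma continuous_integral_levyPsi_comp (hν : Integrable (fun ζ : ℝ => ζ ^ 2) ν) :
    Continuous fun φ : SchwartzR ↦ ∫ x, levyPsi ν (φ x) := by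
  let N₁ (φ : SchwartzR) : ℝ := ∫ x, |φ x|
  have hN₁ : Continuous N₁ := by
    have h : N₁ = fun φ : SchwartzR ↦ ‖φ.toLp 1‖ := by
      ext φ
      rw [L1.norm_eq_integral_norm]
      refine integral_congr_ae ?_
      filter_upwards [φ.coeFn_toLp 1] with x hx
      rw [hx, Real.norm_eq_abs]
    rw [h]
    exact SchwartzMap.continuous_toLp.norm
  let S (φ : SchwartzR) : ℝ := ‖SchwartzMap.toBoundedContinuousFunctionCLM ℝ ℝ ℝ φ‖
  have hS : Continuous S := (SchwartzMap.toBoundedContinuousFunctionCLM ℝ ℝ ℝ).continuous.norm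
  have hbound (φ ψ : SchwartzR) : ‖(∫ x, levyPsi ν (φ x)) - ∫ x, levyPsi ν (ψ x)‖ ≤
      S (φ - ψ) * (N₁ φ + N₁ ψ) * ∫ ζ, ζ ^ 2 ∂ν := by
    rw [← integral_sub (integrable_levyPsi_comp hν φ) (integrable_levyPsi_comp hν ψ),
      ← integral_add φ.integrable.abs ψ.integrable.abs, ← integral_const_mul (S (φ - ψ)),
      ← integral_mul_const]
    refine norm_integral_le_of_norm_le
      (((φ.integrable.abs.add ψ.integrable.abs).const_mul _).mul_const _) (.of_forall fun x ↦ ?_)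
    refine (norm_levyPsi_sub_le hν (φ x) (ψ x)).trans ?_
    have hx : |φ x - ψ x| ≤ S (φ - ψ) :=
      (SchwartzMap.toBoundedContinuousFunctionCLM ℝ ℝ ℝ (φ - ψ)).norm_coe_le_norm x
    have hM : 0 ≤ ∫ ζ, ζ ^ 2 ∂ν := integral_nonneg fun ζ ↦ sq_nonneg ζ
    gcongr
  refine continuous_iff_continuousAt.2 fun ψ ↦ tendsto_iff_norm_sub_tendsto_zero.2 ?_
  refine squeeze_zero (fun _ ↦ norm_nonneg _) (fun φ ↦ hbound φ ψ) ?_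
  exact Continuous.tendsto' (by fun_prop) _ _ (by simp [S])

end LevyPsi

section PosSemidef

variable {ι : Type*} [Fintype ι]

lemma posSemidef_integral {α : Type*} [MeasurableSpace α] {μ : Measure α} {A : α → Matrix ι ι ℂ}
    (hA : ∀ x, (A x).PosSemidef) (hint : ∀ i j, Integrable (fun x ↦ A x i j) μ) :
    (Matrix.of fun i j ↦ ∫ x, A x i j ∂μ).PosSemidef := by
  refine .of_dotProduct_mulVec_nonneg ?_ fun v ↦ ?_
  · ext i j
    simp only [Matrix.conjTranspose_apply, Matrix.of_apply, ← starRingEnd_apply]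
    rw [← integral_conj]
    exact integral_congr_ae (.of_forall fun x ↦ (hA x).1.apply i j)
  · have h : star v ⬝ᵥ ((Matrix.of fun i j ↦ ∫ x, A x i j ∂μ).mulVec v) =
        ∫ x, star v ⬝ᵥ ((A x).mulVec v) ∂μ := by
      simp only [dotProduct, Matrix.mulVec, Matrix.of_apply]
      rw [integral_finsetSum _ fun i _ ↦
        (integrable_finsetSum _ fun j _ ↦ (hint i j).mul_const _).const_mul _]
      refine Finset.sum_congr rfl fun i _ ↦ ?_
      rw [integral_const_mul, integral_finsetSum _ fun j _ ↦ (hint i j).mul_const _]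
      simp only [integral_mul_const]
    rw [h]
    exact integral_nonneg fun x ↦ (hA x).dotProduct_mulVec_nonneg v

lemma Matrix.PosSemidef.map_pow {A : Matrix ι ι ℂ} (hA : A.PosSemidef) (k : ℕ) :
    (A.map (· ^ k)).PosSemidef := by
  induction k with
  | zero =>
    convert Matrix.posSemidef_vecMulVec_self_star (1 : ι → ℂ)
    ext i j
    simp [Matrix.vecMulVec_apply]
  | succ k ih =>
    have h : A.map (· ^ (k + 1)) = (A.map (· ^ k)).hadamard A := by
      ext i j
      simp [pow_succ]
    rw [h]
    exact ih.hadamard hA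

/-- The entrywise exponential of a positive semidefinite matrix is positive semidefinite. -/
lemma Matrix.PosSemidef.map_cexp {A : Matrix ι ι ℂ} (hA : A.PosSemidef) :
    (A.map Complex.exp).PosSemidef := by
  refine .of_dotProduct_mulVec_nonneg ?_ fun v ↦ ?_
  · ext i j
    simp only [Matrix.conjTranspose_apply, Matrix.map_apply, ← starRingEnd_apply]
    rw [← Complex.exp_conj, starRingEnd_apply, hA.1.apply]
  · have h : HasSum (fun k : ℕ ↦ (k.factorial : ℂ)⁻¹ * (star v ⬝ᵥ ((A.map (· ^ k)).mulVec v)))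
        (star v ⬝ᵥ ((A.map Complex.exp).mulVec v)) := by
      simp only [dotProduct, Matrix.mulVec, Matrix.map_apply, Finset.mul_sum]
      refine hasSum_sum fun i _ ↦ hasSum_sum fun j _ ↦ ?_
      have hexp : HasSum (fun k : ℕ ↦ A i j ^ k / (k.factorial : ℂ)) (Complex.exp (A i j)) := by
        rw [Complex.exp_eq_exp_ℂ]
        exact NormedSpace.expSeries_div_hasSum_exp (A i j)
      have hterm (k : ℕ) : (k.factorial : ℂ)⁻¹ * (star v i * (A i j ^ k * v j)) =
          star v i * (A i j ^ k / (k.factorial : ℂ) * v j) := by ring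
      simp only [hterm]
      exact (hexp.mul_right (v j)).mul_left (star v i)
    exact h.nonneg fun k ↦ mul_nonneg (by positivity) ((hA.map_pow k).dotProduct_mulVec_nonneg v)

lemma posSemidef_levyPsi_sub {ν : Measure ℝ} (hν : Integrable (fun ζ : ℝ => ζ ^ 2) ν) (w : ι → ℝ) :
    (Matrix.of fun i j ↦
      levyPsi ν (w i - w j) - levyPsi ν (w i) - levyPsi ν (-w j)).PosSemidef := by
  let e (a ζ : ℝ) : ℂ :=
    Complex.exp (Complex.I * (a : ℂ) * (ζ : ℂ)) - 1 - Complex.I * (a : ℂ) * (ζ : ℂ)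
  have he (a : ℝ) : Integrable (e a) ν := integrable_levyPsi_integrand hν a
  have hA (ζ : ℝ) :
      (Matrix.of fun i j ↦ e (w i - w j) ζ - e (w i) ζ - e (-w j) ζ).PosSemidef := by
    convert Matrix.posSemidef_vecMulVec_self_star
      (fun i ↦ Complex.exp (Complex.I * (w i : ℂ) * (ζ : ℂ)) - 1)
    ext i j
    have hexp : Complex.exp (Complex.I * ((w i - w j : ℝ) : ℂ) * (ζ : ℂ)) =
        Complex.exp (Complex.I * (w i : ℂ) * (ζ : ℂ)) *
          Complex.exp (Complex.I * ((-w j : ℝ) : ℂ) * (ζ : ℂ)) := by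
      rw [← Complex.exp_add]
      push_cast
      ring_nf
    have hstar : star (Complex.exp (Complex.I * (w j : ℂ) * (ζ : ℂ))) =
        Complex.exp (Complex.I * ((-w j : ℝ) : ℂ) * (ζ : ℂ)) := by
      rw [← starRingEnd_apply, ← Complex.exp_conj]
      simp
    simp only [e, Matrix.of_apply, Matrix.vecMulVec_apply, Pi.star_apply, star_sub, star_one, hstar,
      hexp]
    push_cast
    ring
  convert posSemidef_integral hA fun i j ↦ ((he _).sub (he _)).sub (he _) using 1
  ext i j
  simp only [Matrix.of_apply]
  rw [integral_sub_sub (he _) (he _) (he _)]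
  rfl

end PosSemidef

/-- For a σ-finite measure `ν` on `ℝ` with `∫ ζ² dν < ∞`, the Lévy functional
`h(φ) = exp(∫ Ψ(φ(x)) dx)` satisfies: (i) `h(0) = 1`; (ii) `h` is continuous with respect
to the Fréchet topology of `𝒮(ℝ)`; (iii) `h` is positive definite. -/
theorem levyFunctional_bochner_minlos_conditions
    (ν : Measure ℝ) [SigmaFinite ν] (hν : Integrable (fun ζ : ℝ => ζ^2) ν) :
    levyFunctional ν 0 = 1 ∧
    Continuous (levyFunctional ν) ∧
    ∀ (n : ℕ) (z : Fin n → ℂ) (φ : Fin n → SchwartzR),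
      0 ≤ ∑ j, ∑ l, z j * (starRingEnd ℂ) (z l) * levyFunctional ν (φ j - φ l) := by
  refine ⟨by simp [levyFunctional],
    Complex.continuous_exp.comp (continuous_integral_levyPsi_comp hν), fun n z φ ↦ ?_⟩
  have hsub (j l : Fin n) : Integrable fun x ↦ levyPsi ν (φ j x - φ l x) :=
    integrable_levyPsi_comp hν (φ j - φ l)
  have hneg (l : Fin n) : Integrable fun x ↦ levyPsi ν (-φ l x) :=
    integrable_levyPsi_comp hν (-φ l)
  have hφ (j : Fin n) : Integrable fun x ↦ levyPsi ν (φ j x) := integrable_levyPsi_comp hν (φ j)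
  have hG := (posSemidef_integral (fun x ↦ posSemidef_levyPsi_sub hν fun j ↦ φ j x)
    fun j l ↦ ((hsub j l).sub (hφ j)).sub (hneg l)).map_cexp
  convert hG.dotProduct_mulVec_nonneg (fun j ↦ star (z j * levyFunctional ν (φ j))) using 1
  simp only [dotProduct, Matrix.mulVec, Finset.mul_sum]
  refine Finset.sum_congr rfl fun j _ ↦ Finset.sum_congr rfl fun l _ ↦ ?_
  have hstar : star (levyFunctional ν (φ l)) = Complex.exp (∫ x, levyPsi ν (-φ l x)) := by
    rw [levyFunctional, ← star_integral_levyPsi_comp, ← starRingEnd_apply, ← Complex.exp_conj,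
      starRingEnd_apply]
  have hfactor : levyFunctional ν (φ j - φ l) = levyFunctional ν (φ j) *
      Complex.exp (∫ x, (levyPsi ν (φ j x - φ l x) - levyPsi ν (φ j x) - levyPsi ν (-φ l x))) *
      star (levyFunctional ν (φ l)) := by
    rw [hstar, integral_sub_sub (hsub j l) (hφ j) (hneg l), levyFunctional, levyFunctional,
      ← Complex.exp_add, ← Complex.exp_add]
    simp only [sub_apply]
    ring_nf
  simp only [hfactor, Matrix.map_apply, Matrix.of_apply, Pi.star_apply, star_star, star_mul,
    starRingEnd_apply]
  ring

end
end

section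
/- Let ν be a σ-finite Borel measure on ℝ with K := ∫_ℝ ζ² dν(ζ) < ∞, and let Ψ(w) = ∫_ℝ (e^{iwζ} − 1 − iwζ) dν(ζ). Suppose Q is a probability measure on 𝒮'(ℝ) (with the Borel σ-algebra of the weak-* topology) such that ∫_{𝒮'(ℝ)} e^{i⟨ω,φ⟩} dQ(ω) = exp(∫_ℝ Ψ(φ(x)) dx) for all φ ∈ 𝒮(ℝ). Then for every φ ∈ 𝒮(ℝ): ∫ ⟨ω,φ⟩ dQ(ω) = 0 and ∫ ⟨ω,φ⟩² dQ(ω) = K·∫_ℝ φ(x)² dx. -/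
open MeasureTheory

noncomputable section

open Filter Topology

/-- The first-order Taylor remainder `e^{iy} − 1 − iy` of the imaginary exponential. -/
def expRemainder (y : ℝ) : ℂ :=
  Complex.exp (Complex.I * (y : ℂ)) - 1 - Complex.I * (y : ℂ)

lemma continuous_expRemainder : Continuous expRemainder := by
  unfold expRemainder
  fun_prop

lemma expRemainder_re (y : ℝ) : (expRemainder y).re = Real.cos y - 1 := by
  simp [expRemainder, Complex.exp_re]

lemma norm_expRemainder_le (y : ℝ) : ‖expRemainder y‖ ≤ 2 * y ^ 2 := by
  have hI : ‖Complex.I * (y : ℂ)‖ = |y| := by simp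
  rcases le_total |y| 1 with h | h
  · have := Complex.norm_exp_sub_one_sub_id_le (x := Complex.I * (y : ℂ)) (by rwa [hI])
    rw [hI, sq_abs] at this
    unfold expRemainder
    nlinarith [sq_nonneg y]
  · have h1 := Real.norm_exp_I_mul_ofReal_sub_one_le (x := y)
    have h2 := norm_sub_le (Complex.exp (Complex.I * (y : ℂ)) - 1) (Complex.I * (y : ℂ))
    rw [hI] at h2
    rw [Real.norm_eq_abs] at h1
    unfold expRemainder
    nlinarith [sq_abs y]

lemma norm_expRemainder_add_le {y : ℝ} (hy : |y| ≤ 1) :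
    ‖expRemainder y + (y : ℂ) ^ 2 / 2‖ ≤ |y| ^ 3 := by
  have hI : ‖Complex.I * (y : ℂ)‖ = |y| := by simp
  have h := Complex.exp_bound (x := Complex.I * (y : ℂ)) (by rwa [hI]) (n := 3) (by norm_num)
  rw [hI] at h
  have e : expRemainder y + (y : ℂ) ^ 2 / 2 = Complex.exp (Complex.I * (y : ℂ)) -
      ∑ m ∈ Finset.range 3, (Complex.I * (y : ℂ)) ^ m / (m.factorial : ℂ) := by
    simp [Finset.sum_range_succ, expRemainder, mul_pow, Nat.factorial]
    ring
  rw [e]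
  refine h.trans ?_
  have : (0 : ℝ) ≤ |y| ^ 3 := by positivity
  norm_num [Nat.factorial]
  nlinarith

lemma tendsto_expRemainder_div_sq (a : ℝ) :
    Tendsto (fun t : ℝ => expRemainder (t * a) / (t : ℂ) ^ 2) (𝓝[≠] 0)
      (𝓝 (-((a : ℂ) ^ 2 / 2))) := by
  rw [tendsto_iff_norm_sub_tendsto_zero]
  have hb : Tendsto (fun t : ℝ => |t| * |a| ^ 3) (𝓝[≠] 0) (𝓝 0) := by
    have : Continuous fun t : ℝ => |t| * |a| ^ 3 := by fun_prop
    simpa using (this.tendsto 0).mono_left nhdsWithin_le_nhds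
  have hs : ∀ᶠ t : ℝ in 𝓝[≠] 0, |t * a| ≤ 1 := by
    have : Continuous fun t : ℝ => |t * a| := by fun_prop
    have h0 := (this.tendsto 0).mono_left (nhdsWithin_le_nhds (s := {0}ᶜ))
    refine h0.eventually (eventually_le_nhds ?_)
    simp
  refine squeeze_zero' (Eventually.of_forall fun _ => norm_nonneg _) ?_ hb
  filter_upwards [hs, self_mem_nhdsWithin] with t ht ht0
  have ht0 : t ≠ 0 := ht0
  have htc : (t : ℂ) ≠ 0 := by exact_mod_cast ht0
  have e : expRemainder (t * a) / (t : ℂ) ^ 2 - -((a : ℂ) ^ 2 / 2)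
      = (expRemainder (t * a) + ((t * a : ℝ) : ℂ) ^ 2 / 2) / (t : ℂ) ^ 2 := by
    push_cast
    field_simp
    ring
  rw [e, norm_div, norm_pow, Complex.norm_real, Real.norm_eq_abs,
    div_le_iff₀ (by positivity)]
  refine (norm_expRemainder_add_le ht).trans_eq ?_
  rw [abs_mul]
  ring

section Moments

variable {α : Type*} [MeasurableSpace α] {μ : Measure α} {f : α → ℝ}

lemma integrable_expRemainder (hf : AEStronglyMeasurable f μ)
    (hf2 : Integrable (fun x => f x ^ 2) μ) (t : ℝ) :
    Integrable (fun x => expRemainder (t * f x)) μ := by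
  refine Integrable.mono' (hf2.const_mul (2 * t ^ 2))
    (continuous_expRemainder.comp_aestronglyMeasurable (hf.const_mul t))
    (Eventually.of_forall fun x => ?_)
  refine (norm_expRemainder_le _).trans_eq ?_
  ring

lemma tendsto_integral_expRemainder_div_sq (hf : AEStronglyMeasurable f μ)
    (hf2 : Integrable (fun x => f x ^ 2) μ) :
    Tendsto (fun t : ℝ => (∫ x, expRemainder (t * f x) ∂μ) / (t : ℂ) ^ 2) (𝓝[≠] 0)
      (𝓝 (-(((∫ x, f x ^ 2 ∂μ : ℝ) : ℂ) / 2))) := by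
  have key : Tendsto (fun t : ℝ => ∫ x, expRemainder (t * f x) / (t : ℂ) ^ 2 ∂μ) (𝓝[≠] 0)
      (𝓝 (∫ x, -((f x : ℂ) ^ 2 / 2) ∂μ)) := by
    refine tendsto_integral_filter_of_dominated_convergence (fun x => 2 * f x ^ 2)
      (Eventually.of_forall fun t => ?_) ?_ (hf2.const_mul 2)
      (Eventually.of_forall fun x => tendsto_expRemainder_div_sq (f x))
    · exact ((integrable_expRemainder hf hf2 t).div_const _).aestronglyMeasurable
    · filter_upwards [self_mem_nhdsWithin] with t ht
      refine Eventually.of_forall fun x => ?_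
      have ht : t ≠ 0 := ht
      rw [norm_div, norm_pow, Complex.norm_real, Real.norm_eq_abs, sq_abs,
        div_le_iff₀ (by positivity)]
      refine (norm_expRemainder_le _).trans_eq ?_
      ring
  have e : ∫ x, -((f x : ℂ) ^ 2 / 2) ∂μ = -(((∫ x, f x ^ 2 ∂μ : ℝ) : ℂ) / 2) := by
    rw [integral_neg, integral_div, ← integral_complex_ofReal]
    simp
  rw [e] at key
  simpa only [integral_div] using key

/-- If the symmetric second difference quotients of the characteristic function at `0` converge,
then the second moment is finite. -/
lemma integrable_sq_of_tendsto_integral_one_sub_cos [IsFiniteMeasure μ]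
    (hf : AEStronglyMeasurable f μ) {L : ℝ}
    (h : Tendsto (fun t : ℝ => ∫ x, (1 - Real.cos (t * f x)) / t ^ 2 ∂μ) (𝓝[≠] 0) (𝓝 L)) :
    Integrable (fun x => f x ^ 2) μ := by
  have hmeas : ∀ t : ℝ, AEStronglyMeasurable (fun x => (1 - Real.cos (t * f x)) / t ^ 2) μ := by
    intro t
    have : Continuous fun y : ℝ => (1 - Real.cos (t * y)) / t ^ 2 := by fun_prop
    exact this.comp_aestronglyMeasurable hf
  have hnn : ∀ t y : ℝ, 0 ≤ (1 - Real.cos (t * y)) / t ^ 2 := fun t y =>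
    div_nonneg (sub_nonneg.2 (Real.cos_le_one _)) (sq_nonneg t)
  have hint : ∀ t : ℝ, Integrable (fun x => (1 - Real.cos (t * f x)) / t ^ 2) μ := by
    intro t
    refine Integrable.of_bound (hmeas t) (2 / t ^ 2) (Eventually.of_forall fun x => ?_)
    rw [Real.norm_eq_abs, abs_of_nonneg (hnn t _)]
    gcongr
    linarith [Real.neg_one_le_cos (t * f x)]
  have hlim : ∀ y : ℝ, Tendsto (fun t : ℝ => (1 - Real.cos (t * y)) / t ^ 2) (𝓝[≠] 0)
      (𝓝 (y ^ 2 / 2)) := by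
    intro y
    have := ((Complex.continuous_re.tendsto _).comp (tendsto_expRemainder_div_sq y)).neg
    have e2 : -(-((y : ℂ) ^ 2 / 2)).re = y ^ 2 / 2 := by
      rw [show -((y : ℂ) ^ 2 / 2) = ((-(y ^ 2 / 2) : ℝ) : ℂ) by push_cast; rfl,
        Complex.ofReal_re, neg_neg]
    rw [e2] at this
    refine this.congr fun t => ?_
    rw [Function.comp_apply, ← Complex.ofReal_pow, Complex.div_ofReal_re, expRemainder_re]
    ring
  have hfatou : ∫⁻ x, ENNReal.ofReal (f x ^ 2 / 2) ∂μ ≤ ENNReal.ofReal L := by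
    calc ∫⁻ x, ENNReal.ofReal (f x ^ 2 / 2) ∂μ
        = ∫⁻ x, liminf (fun t : ℝ => ENNReal.ofReal ((1 - Real.cos (t * f x)) / t ^ 2))
            (𝓝[≠] 0) ∂μ := by
          refine lintegral_congr fun x => ?_
          exact (((ENNReal.continuous_ofReal.tendsto _).comp (hlim (f x))).liminf_eq).symm
      _ ≤ liminf (fun t : ℝ => ∫⁻ x, ENNReal.ofReal ((1 - Real.cos (t * f x)) / t ^ 2) ∂μ)
            (𝓝[≠] 0) := lintegral_liminf_le' fun t => (hmeas t).aemeasurable.ennreal_ofReal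
      _ = ENNReal.ofReal L := by
          refine Tendsto.liminf_eq ?_
          refine ((ENNReal.continuous_ofReal.tendsto _).comp h).congr fun t => ?_
          exact ofReal_integral_eq_lintegral_ofReal (hint t)
            (Eventually.of_forall fun x => hnn t _)
  have hhalf : Integrable (fun x => f x ^ 2 / 2) μ := by
    refine ⟨((continuous_pow 2).div_const 2).comp_aestronglyMeasurable hf, ?_⟩
    rw [hasFiniteIntegral_iff_ofReal (Eventually.of_forall fun x => by positivity)]
    exact hfatou.trans_lt ENNReal.ofReal_lt_top
  simpa using hhalf.mul_const 2

lemma integral_exp_eq [IsProbabilityMeasure μ] (hf : AEStronglyMeasurable f μ)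
    (hf2 : Integrable (fun x => f x ^ 2) μ) (t : ℝ) :
    ∫ x, Complex.exp (Complex.I * ((t * f x : ℝ) : ℂ)) ∂μ
      = (∫ x, expRemainder (t * f x) ∂μ) + 1 + Complex.I * t * ((∫ x, f x ∂μ : ℝ) : ℂ) := by
  have hf1 : Integrable f μ :=
    ((memLp_two_iff_integrable_sq hf).2 hf2).integrable (by norm_num)
  have e : ∀ x, Complex.exp (Complex.I * ((t * f x : ℝ) : ℂ))
      = (expRemainder (t * f x) + 1) + Complex.I * t * (f x : ℂ) := by
    intro x
    simp only [expRemainder]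
    push_cast
    ring
  simp_rw [e]
  have h1 := integrable_expRemainder hf hf2 t
  have h3 : Integrable (fun x => Complex.I * t * (f x : ℂ)) μ := hf1.ofReal.const_mul _
  have h2 : Integrable (fun x => expRemainder (t * f x) + 1) μ := h1.add (integrable_const 1)
  rw [integral_add h2 h3, integral_add h1 (integrable_const 1),
    integral_const_mul, ← integral_complex_ofReal]
  simp

/-- A random variable whose characteristic function is `1 − C t² / 2 + o(t²)` at `0` is centred
and has second moment `C`. -/
lemma moments_of_tendsto_charFun [IsProbabilityMeasure μ] (hf : AEStronglyMeasurable f μ) {C : ℝ}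
    (h : Tendsto (fun t : ℝ =>
      ((∫ x, Complex.exp (Complex.I * ((t * f x : ℝ) : ℂ)) ∂μ) - 1) / (t : ℂ) ^ 2)
      (𝓝[≠] 0) (𝓝 (-((C : ℂ) / 2)))) :
    ∫ x, f x ∂μ = 0 ∧ ∫ x, f x ^ 2 ∂μ = C := by
  have hre : ∀ z : ℝ, (-((z : ℂ) / 2)).re = -(z / 2) := fun z => by
    exact_mod_cast Complex.ofReal_re (-(z / 2))
  have hexp : ∀ t : ℝ, Integrable (fun x => Complex.exp (Complex.I * ((t * f x : ℝ) : ℂ))) μ := by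
    intro t
    have hc : Continuous fun y : ℝ => Complex.exp (Complex.I * ((t * y : ℝ) : ℂ)) := by fun_prop
    refine Integrable.of_bound (hc.comp_aestronglyMeasurable hf) 1 (Eventually.of_forall fun x => ?_)
    rw [mul_comm, Complex.norm_exp_ofReal_mul_I]
  have hf2 : Integrable (fun x => f x ^ 2) μ := by
    refine integrable_sq_of_tendsto_integral_one_sub_cos hf (L := C / 2) ?_
    have hr := ((Complex.continuous_re.tendsto _).comp h).neg
    rw [hre, neg_neg] at hr
    refine hr.congr fun t => ?_
    have hi := (hexp t).re
    have hcos : (∫ x, Complex.exp (Complex.I * ((t * f x : ℝ) : ℂ)) ∂μ).re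
        = ∫ x, Real.cos (t * f x) ∂μ := by
      have := integral_re (hexp t)
      simp only [RCLike.re_eq_complex_re] at this
      rw [← this]
      refine integral_congr_ae (Eventually.of_forall fun x => ?_)
      simp [Complex.exp_re]
    have hicos : Integrable (fun x => Real.cos (t * f x)) μ := by
      refine hi.congr (Eventually.of_forall fun x => ?_)
      simp [Complex.exp_re]
    rw [Function.comp_apply, ← Complex.ofReal_pow, Complex.div_ofReal_re, Complex.sub_re, hcos,
      integral_div, integral_sub (integrable_const 1) hicos]
    simp
    ring
  have hR := tendsto_integral_expRemainder_div_sq hf hf2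
  have hdiff := h.sub hR
  have heq : ∀ᶠ t : ℝ in 𝓝[≠] 0,
      ((∫ x, Complex.exp (Complex.I * ((t * f x : ℝ) : ℂ)) ∂μ) - 1) / (t : ℂ) ^ 2
        - (∫ x, expRemainder (t * f x) ∂μ) / (t : ℂ) ^ 2
      = Complex.I * ((∫ x, f x ∂μ : ℝ) : ℂ) / t := by
    filter_upwards [self_mem_nhdsWithin] with t ht
    have htc : (t : ℂ) ≠ 0 := by exact_mod_cast (show t ≠ 0 from ht)
    rw [integral_exp_eq hf hf2]
    field_simp
    ring
  have hlim := hdiff.congr' heq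
  constructor
  · have ht : Tendsto (fun t : ℝ => (t : ℂ)) (𝓝[≠] 0) (𝓝 0) := by
      simpa using (Complex.continuous_ofReal.tendsto 0).mono_left nhdsWithin_le_nhds
    have h0 := hlim.mul ht
    rw [mul_zero] at h0
    have hc : Tendsto (fun _ : ℝ => Complex.I * ((∫ x, f x ∂μ : ℝ) : ℂ)) (𝓝[≠] 0) (𝓝 0) := by
      refine h0.congr' ?_
      filter_upwards [self_mem_nhdsWithin] with t ht
      have htc : (t : ℂ) ≠ 0 := by exact_mod_cast (show t ≠ 0 from ht)
      field_simp
    simpa using tendsto_nhds_unique tendsto_const_nhds hc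
  · have hr := (Complex.continuous_re.tendsto _).comp hlim
    rw [Complex.sub_re, hre, hre] at hr
    have hc : Tendsto (fun _ : ℝ => (0 : ℝ)) (𝓝[≠] (0 : ℝ))
        (𝓝 (-(C / 2) - -((∫ x, f x ^ 2 ∂μ) / 2))) := by
      refine hr.congr fun t => ?_
      simp [Complex.div_ofReal_re]
    linarith [tendsto_nhds_unique tendsto_const_nhds hc]

end Moments

lemma tendsto_cexp_sub_one_div {ι : Type*} {l : Filter ι} {F s : ι → ℂ} {a : ℂ}
    (hF : Tendsto F l (𝓝 0)) (h : Tendsto (fun t => F t / s t) l (𝓝 a)) :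
    Tendsto (fun t => (Complex.exp (F t) - 1) / s t) l (𝓝 a) := by
  have hd : ContinuousAt (dslope Complex.exp 0) 0 :=
    continuousAt_dslope_same.2 Complex.differentiableAt_exp
  have hd' := hd.tendsto.comp hF
  rw [dslope_same, Complex.deriv_exp, Complex.exp_zero] at hd'
  have := h.mul hd'
  rw [mul_one] at this
  refine this.congr fun t => ?_
  have e := sub_smul_dslope Complex.exp 0 (F t)
  rw [sub_zero, smul_eq_mul, Complex.exp_zero] at e
  rw [← e, Function.comp_apply]
  ring

lemma integral_levyPsi_smul {ν : Measure ℝ} [SigmaFinite ν]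
    (hν : Integrable (fun ζ : ℝ => ζ ^ 2) ν) (φ : SchwartzR) (t : ℝ) :
    ∫ x, levyPsi ν ((t • φ) x)
      = ∫ z : ℝ × ℝ, expRemainder (t * (φ z.1 * z.2)) ∂(volume.prod ν) := by
  have hφ : Integrable (fun x => φ x ^ 2) := (φ.memLp 2).integrable_sq
  have hm : Continuous fun z : ℝ × ℝ => φ z.1 * z.2 :=
    (φ.continuous.comp continuous_fst).mul continuous_snd
  have h2 : Integrable (fun z : ℝ × ℝ => (φ z.1 * z.2) ^ 2) (volume.prod ν) := by
    simpa only [mul_pow] using hφ.mul_prod hν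
  rw [integral_prod _ (integrable_expRemainder hm.aestronglyMeasurable h2 t)]
  refine integral_congr_ae (Eventually.of_forall fun x => ?_)
  refine integral_congr_ae (Eventually.of_forall fun ζ => ?_)
  simp [expRemainder, mul_assoc]

lemma tendsto_levyFunctional_sub_one_div_sq {ν : Measure ℝ} [SigmaFinite ν]
    (hν : Integrable (fun ζ : ℝ => ζ ^ 2) ν) (φ : SchwartzR) :
    Tendsto (fun t : ℝ => (levyFunctional ν (t • φ) - 1) / (t : ℂ) ^ 2) (𝓝[≠] 0)
      (𝓝 (-((((∫ ζ, ζ ^ 2 ∂ν) * ∫ x, (φ x) ^ 2 : ℝ) : ℂ) / 2))) := by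
  have hφ : Integrable (fun x => φ x ^ 2) := (φ.memLp 2).integrable_sq
  have hm : Continuous fun z : ℝ × ℝ => φ z.1 * z.2 :=
    (φ.continuous.comp continuous_fst).mul continuous_snd
  have h2 : Integrable (fun z : ℝ × ℝ => (φ z.1 * z.2) ^ 2) (volume.prod ν) := by
    simpa only [mul_pow] using hφ.mul_prod hν
  have hlim := tendsto_integral_expRemainder_div_sq hm.aestronglyMeasurable h2
  have e : ∫ z : ℝ × ℝ, (φ z.1 * z.2) ^ 2 ∂(volume.prod ν)
      = (∫ ζ, ζ ^ 2 ∂ν) * ∫ x, (φ x) ^ 2 := by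
    simp_rw [mul_pow]
    rw [integral_prod_mul (fun x => φ x ^ 2) (fun ζ : ℝ => ζ ^ 2), mul_comm]
  rw [e] at hlim
  unfold levyFunctional
  simp_rw [integral_levyPsi_smul hν]
  refine tendsto_cexp_sub_one_div ?_ hlim
  have ht : Tendsto (fun t : ℝ => (t : ℂ) ^ 2) (𝓝[≠] 0) (𝓝 0) := by
    have : Continuous fun t : ℝ => (t : ℂ) ^ 2 := by fun_prop
    simpa using (this.tendsto 0).mono_left nhdsWithin_le_nhds
  have h0 := hlim.mul ht
  rw [mul_zero] at h0
  refine h0.congr' ?_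
  filter_upwards [self_mem_nhdsWithin] with t ht
  have htc : (t : ℂ) ≠ 0 := by exact_mod_cast (show t ≠ 0 from ht)
  field_simp

/-- If `Q` is a probability measure on `𝒮'(ℝ)` whose characteristic functional is the Lévy
functional of a σ-finite measure `ν` with `K = ∫ ζ² dν < ∞`, then for every `φ ∈ 𝒮(ℝ)`:
`∫ ⟨ω,φ⟩ dQ = 0` and `∫ ⟨ω,φ⟩² dQ = K ∫ φ(x)² dx`. -/
theorem levy_whiteNoise_moments
    (ν : Measure ℝ) [SigmaFinite ν] (hν : Integrable (fun ζ : ℝ => ζ^2) ν)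
    (Q : Measure TemperedDistR) [IsProbabilityMeasure Q]
    (hQ : ∀ φ : SchwartzR,
      ∫ ω, Complex.exp (Complex.I * ((ω φ : ℝ) : ℂ)) ∂Q = levyFunctional ν φ)
    (φ : SchwartzR) :
    (∫ ω, (ω φ : ℝ) ∂Q = 0) ∧
    (∫ ω, (ω φ : ℝ)^2 ∂Q = (∫ ζ, ζ^2 ∂ν) * ∫ x, (φ x)^2) := by
  have : OpensMeasurableSpace TemperedDistR := ⟨le_rfl⟩
  have hm : AEStronglyMeasurable (fun ω : TemperedDistR => (ω φ : ℝ)) Q :=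
    (WeakDual.eval_continuous φ).measurable.aestronglyMeasurable
  refine moments_of_tendsto_charFun hm ?_
  refine (tendsto_levyFunctional_sub_one_div_sq hν φ).congr fun t => ?_
  rw [← hQ (t • φ)]
  simp only [map_smul, smul_eq_mul]

end
end
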